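/- arXiv:1405.0030 — 10 statements merged into one kernel-verified Lean document; each statement's English description precedes it below -/
import Mathlib

section
/- Let 0<ν<1, σ=1−ν/2, τ>0, and set t_j=jτ and t_{n+σ}=(n+σ)τ. There exists a constant C depending only on ν such that for every n≥0 and every function u∈C³[0,t_{n+1}], the L2-1_σ approximation satisfies |∂₀ₜ^ν u(t_{n+σ}) − Δ₀ₜ_{n+σ}^ν u| ≤ C·(max_{0≤t≤t_{n+1}}|u'''(t)|)·τ^{3−ν}. -/
open scoped BigOperators

/-- The Caputo fractional derivative of order `ν ∈ (0,1)`: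
`∂₀ₜ^ν u(t) = (1/Γ(1−ν)) ∫₀ᵗ u'(s)(t−s)^{−ν} ds`. -/
noncomputable def caputoDeriv (ν : ℝ) (u : ℝ → ℝ) (t : ℝ) : ℝ :=
  (1 / Real.Gamma (1 - ν)) * ∫ s in (0 : ℝ)..t, deriv u s * (t - s) ^ (-ν)

/-- `a_l^{(ν,σ)}`: `a₀ = σ^{1−ν}`, `a_l = (l+σ)^{1−ν} − (l−1+σ)^{1−ν}` for `l ≥ 1`. -/
noncomputable def acoef (ν σ : ℝ) : ℕ → ℝ
  | 0 => σ ^ (1 - ν)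
  | (l + 1) => ((l : ℝ) + 1 + σ) ^ (1 - ν) - ((l : ℝ) + σ) ^ (1 - ν)

/-- `b_l^{(ν,σ)} = ((l+σ)^{2−ν} − (l−1+σ)^{2−ν})/(2−ν) − ((l+σ)^{1−ν} + (l−1+σ)^{1−ν})/2`. -/
noncomputable def bcoef (ν σ : ℝ) (l : ℕ) : ℝ :=
  (((l : ℝ) + σ) ^ (2 - ν) - ((l : ℝ) - 1 + σ) ^ (2 - ν)) / (2 - ν)
    - (((l : ℝ) + σ) ^ (1 - ν) + ((l : ℝ) - 1 + σ) ^ (1 - ν)) / 2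

/-- The L2-1_σ coefficients `c_s^{(ν,σ)}` (for the time level `n`). -/
noncomputable def ccoef (ν σ : ℝ) (n s : ℕ) : ℝ :=
  if n = 0 then acoef ν σ 0
  else if s = 0 then acoef ν σ 0 + bcoef ν σ 1
  else if s = n then acoef ν σ n - bcoef ν σ n
  else acoef ν σ s + bcoef ν σ (s + 1) - bcoef ν σ s

/-- The discrete (L2-1_σ) fractional derivative
`Δ₀ₜ_{n+σ}^ν y = (τ^{−ν}/Γ(2−ν)) Σ_{s=0}^n c_{n−s}^{(ν,σ)}(y^{s+1} − y^s)`. -/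
noncomputable def discFracDeriv (ν σ τ : ℝ) (n : ℕ) (y : ℕ → ℝ) : ℝ :=
  (τ ^ (-ν) / Real.Gamma (2 - ν)) *
    ∑ s ∈ Finset.range (n + 1), ccoef ν σ n (n - s) * (y (s + 1) - y s)


lemma aux_mvt (f : ℝ → ℝ) (a b C : ℝ) (hab : a ≤ b) (hc : ContinuousOn f (Set.Icc a b))
    (hd : ∀ x ∈ Set.Ioo a b, ∃ d, HasDerivAt f d x ∧ |d| ≤ C) :
    |f b - f a| ≤ C * (b - a) := by
  rcases hab.eq_or_lt with rfl | h
  · simp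
  · obtain ⟨c, hcm, hceq⟩ := exists_deriv_eq_slope f h hc (fun x hx => by
      obtain ⟨d, hd, _⟩ := hd x hx
      exact hd.differentiableAt.differentiableWithinAt)
    obtain ⟨d, hd, hdC⟩ := hd c hcm
    rw [hd.deriv] at hceq
    have hba : 0 < b - a := sub_pos.2 h
    have : f b - f a = d * (b - a) := by rw [hceq]; field_simp
    rw [this, abs_mul, abs_of_pos hba]
    exact mul_le_mul_of_nonneg_right hdC hba.le

/-- Lipschitz bound in symmetric form. -/
lemma aux_mvt_symm (f : ℝ → ℝ) (a b C x y : ℝ) (hc : ContinuousOn f (Set.Icc a b))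
    (hx : x ∈ Set.Icc a b) (hy : y ∈ Set.Icc a b)
    (hd : ∀ z ∈ Set.Ioo (min x y) (max x y), ∃ d, HasDerivAt f d z ∧ |d| ≤ C) :
    |f x - f y| ≤ C * |x - y| := by
  rcases le_total x y with h | h
  · rw [abs_sub_comm, abs_sub_comm x y, abs_of_nonneg (sub_nonneg.2 h)]
    apply aux_mvt f x y C h (hc.mono (Set.Icc_subset_Icc hx.1 hy.2))
    simpa [h] using hd
  · rw [abs_of_nonneg (sub_nonneg.2 h)]
    apply aux_mvt f y x C h (hc.mono (Set.Icc_subset_Icc hy.1 hx.2))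
    simpa [h] using hd

structure Smooth3 (L M : ℝ) (u f1 f2 : ℝ → ℝ) : Prop where
  cu : ContinuousOn u (Set.Icc 0 L)
  c1 : ContinuousOn f1 (Set.Icc 0 L)
  c2 : ContinuousOn f2 (Set.Icc 0 L)
  du : ∀ x ∈ Set.Ioo 0 L, HasDerivAt u (f1 x) x
  d1 : ∀ x ∈ Set.Ioo 0 L, HasDerivAt f1 (f2 x) x
  d2 : ∀ x ∈ Set.Ioo 0 L, ∃ d, HasDerivAt f2 d x ∧ |d| ≤ M
  hM : 0 ≤ M

lemma Ioo_minmax {L x y z : ℝ} (hx : x ∈ Set.Icc 0 L) (hy : y ∈ Set.Icc 0 L)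
    (hz : z ∈ Set.Ioo (min x y) (max x y)) : z ∈ Set.Ioo 0 L ∧ |z - y| ≤ |x - y| := by
  rcases le_total x y with h | h
  · simp only [min_eq_left h, max_eq_right h] at hz
    refine ⟨⟨hx.1.trans_lt hz.1, hz.2.trans_le hy.2⟩, ?_⟩
    rw [abs_of_nonpos (by linarith [hz.2]), abs_of_nonpos (by linarith)]
    linarith [hz.1]
  · simp only [min_eq_right h, max_eq_left h] at hz
    refine ⟨⟨hy.1.trans_lt hz.1, hz.2.trans_le hx.2⟩, ?_⟩
    rw [abs_of_nonneg (by linarith [hz.1]), abs_of_nonneg (by linarith)]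
    linarith [hz.2]

lemma Smooth3.taylor1 {L M : ℝ} {u f1 f2 : ℝ → ℝ} (H : Smooth3 L M u f1 f2) {x c R : ℝ}
    (hx : x ∈ Set.Icc 0 L) (hc : c ∈ Set.Icc 0 L) (hR : |x - c| ≤ R) :
    |f1 x - f1 c - f2 c * (x - c)| ≤ M * R ^ 2 := by
  have hM := H.hM
  have hR0 : 0 ≤ R := (abs_nonneg _).trans hR
  have key := aux_mvt_symm (fun y => f1 y - f2 c * y) 0 L (M * R) x c
    (H.c1.sub (by fun_prop)) hx hc (fun z hz => by
      obtain ⟨hz1, hz2⟩ := Ioo_minmax hx hc hz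
      refine ⟨f2 z - f2 c * 1, (H.d1 z hz1).sub ((hasDerivAt_id z).const_mul _), ?_⟩
      have := aux_mvt_symm f2 0 L M z c H.c2 ⟨hz1.1.le, hz1.2.le⟩ hc (fun y hy =>
        H.d2 y (Ioo_minmax ⟨hz1.1.le, hz1.2.le⟩ hc hy).1)
      rw [mul_one]
      exact this.trans (mul_le_mul_of_nonneg_left (hz2.trans hR) hM))
  have e : f1 x - f1 c - f2 c * (x - c) = f1 x - f2 c * x - (f1 c - f2 c * c) := by ring
  rw [e]
  refine key.trans ?_
  calc M * R * |x - c| ≤ M * R * R := by gcongr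
    _ = _ := by ring

lemma Smooth3.taylor2 {L M : ℝ} {u f1 f2 : ℝ → ℝ} (H : Smooth3 L M u f1 f2) {p q c R : ℝ}
    (hp : 0 ≤ p) (hpq : p ≤ q) (hq : q ≤ L) (hc : c ∈ Set.Icc 0 L)
    (hR1 : c - R ≤ p) (hR2 : q ≤ c + R) :
    |u q - u p - f1 c * (q - p) - f2 c * ((q - c) ^ 2 - (p - c) ^ 2) / 2|
      ≤ M * R ^ 2 * (q - p) := by
  have key := aux_mvt (fun y => u y - (f1 c * y + f2 c * (y - c) ^ 2 / 2)) p q (M * R ^ 2) hpq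
    ((H.cu.mono (Set.Icc_subset_Icc hp hq)).sub (by fun_prop)) (fun z hz => by
      have hz1 : z ∈ Set.Ioo 0 L := ⟨hp.trans_lt hz.1, hz.2.trans_le hq⟩
      refine ⟨f1 z - (f1 c + f2 c * (z - c)), (H.du z hz1).sub ?_, ?_⟩
      · have h1 := ((hasDerivAt_id z).const_mul (f1 c)).add
          (((((hasDerivAt_id z).sub_const c).pow 2).const_mul (f2 c)).div_const 2)
        convert h1 using 1
        · ext y; simp
        · simp; ring
      · have := H.taylor1 (x := z) (c := c) (R := R) ⟨hz1.1.le, hz1.2.le⟩ hc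
          (by rw [abs_le]; constructor <;> linarith [hz.1, hz.2])
        rwa [sub_sub] at this)
  convert key using 2
  ring

lemma weight_int (ν T p q : ℝ) (hν1 : ν < 1) :
    ∫ s in p..q, (T - s) ^ (-ν) = ((T - p) ^ (1 - ν) - (T - q) ^ (1 - ν)) / (1 - ν) := by
  rw [intervalIntegral.integral_comp_sub_left (fun x => x ^ (-ν)) T,
    integral_rpow (Or.inl (by linarith))]
  congr 1 <;> ring_nf

lemma weight_ii (ν T p q : ℝ) (hν1 : ν < 1) :
    IntervalIntegrable (fun s => (T - s) ^ (-ν)) MeasureTheory.volume p q := by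
  have := (intervalIntegral.intervalIntegrable_rpow' (a := T - p) (b := T - q) (r := -ν)
    (by linarith)).comp_sub_left T
  simpa using this

lemma weight_int1 (ν T m p q : ℝ) (hν1 : ν < 1) (hpq : p ≤ q) (hq : q ≤ T) :
    ∫ s in p..q, (s - m) * (T - s) ^ (-ν) =
      (T - m) * ((T - p) ^ (1 - ν) - (T - q) ^ (1 - ν)) / (1 - ν)
        - ((T - p) ^ (2 - ν) - (T - q) ^ (2 - ν)) / (2 - ν) := by
  have h1 : ∫ s in p..q, (s - m) * (T - s) ^ (-ν) =
      ∫ s in p..q, ((T - m) * (T - s) ^ (-ν) - (T - s) ^ (1 - ν)) := by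
    apply intervalIntegral.integral_congr
    intro s hs
    rw [Set.uIcc_of_le hpq] at hs
    have h0 : 0 ≤ T - s := by linarith [hs.2]
    have : (T - s) ^ (1 - ν) = (T - s) * (T - s) ^ (-ν) := by
      rw [sub_eq_add_neg 1 ν, Real.rpow_add' h0 (by linarith), Real.rpow_one]
    simp only [this]; ring
  rw [h1, intervalIntegral.integral_sub ((weight_ii ν T p q hν1).const_mul _),
    intervalIntegral.integral_const_mul, weight_int ν T p q hν1]
  · have := weight_int (ν - 1) T p q (by linarith)
    rw [show -(ν - 1) = 1 - ν by ring, show 1 - (ν - 1) = 2 - ν by ring] at this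
    rw [this]; ring
  · have := weight_ii (ν - 1) T p q (by linarith)
    rwa [show -(ν - 1) = 1 - ν by ring] at this

lemma weighted_bound (ν T p q K : ℝ) (hν0 : 0 < ν) (hpq : p ≤ q) (hq : q < T)
    (g : ℝ → ℝ) (hg : ContinuousOn g (Set.Icc p q)) (hK : ∀ s ∈ Set.Icc p q, |g s| ≤ K)
    (h0 : ∫ s in p..q, g s = 0) :
    |∫ s in p..q, g s * (T - s) ^ (-ν)| ≤ K * (q - p) * ((T - q) ^ (-ν) - (T - p) ^ (-ν)) := by
  have hgi : IntervalIntegrable g MeasureTheory.volume p q :=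
    ContinuousOn.intervalIntegrable_of_Icc hpq hg
  have hwc : ContinuousOn (fun s => (T - s) ^ (-ν)) (Set.uIcc p q) := by
    rw [Set.uIcc_of_le hpq]
    apply ContinuousOn.rpow_const (by fun_prop)
    intro s hs; left; linarith [hs.2]
  have e : ∫ s in p..q, g s * (T - s) ^ (-ν)
      = ∫ s in p..q, g s * ((T - s) ^ (-ν) - (T - p) ^ (-ν)) := by
    simp_rw [mul_sub]
    rw [intervalIntegral.integral_sub (hgi.mul_continuousOn hwc) (hgi.mul_const _),
      intervalIntegral.integral_mul_const, h0]
    ring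
  rw [e]
  have hK0 : 0 ≤ K := (abs_nonneg _).trans (hK p ⟨le_rfl, hpq⟩)
  have := intervalIntegral.norm_integral_le_of_norm_le_const (a := p) (b := q)
    (C := K * ((T - q) ^ (-ν) - (T - p) ^ (-ν)))
    (f := fun s => g s * ((T - s) ^ (-ν) - (T - p) ^ (-ν))) (fun s hs => by
      rw [Set.uIoc_of_le hpq] at hs
      rw [norm_mul, Real.norm_eq_abs, Real.norm_eq_abs]
      have h1 : (T - p) ^ (-ν) ≤ (T - s) ^ (-ν) :=
        Real.rpow_le_rpow_of_nonpos (by linarith [hs.2]) (by linarith [hs.1]) (by linarith)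
      have h2 : (T - s) ^ (-ν) ≤ (T - q) ^ (-ν) :=
        Real.rpow_le_rpow_of_nonpos (by linarith [hs.2]) (by linarith [hs.2]) (by linarith)
      rw [abs_of_nonneg (sub_nonneg.2 h1)]
      apply mul_le_mul (hK s ⟨hs.1.le, hs.2⟩) (by linarith) (by linarith) hK0)
  rw [Real.norm_eq_abs, abs_of_nonneg (sub_nonneg.2 hpq)] at this
  refine this.trans (le_of_eq ?_)
  ring

lemma ccoef_eq (ν σ : ℝ) (n l : ℕ) (hl : l ≤ n) :
    ccoef ν σ n l = acoef ν σ l + (if l < n then bcoef ν σ (l + 1) else 0)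
      - (if 0 < l then bcoef ν σ l else 0) := by
  unfold ccoef
  by_cases h0 : n = 0
  · have : l = 0 := by omega
    subst this; simp [h0]
  · rw [if_neg h0]
    by_cases hl0 : l = 0
    · subst hl0
      simp [Nat.pos_of_ne_zero h0]
    · rw [if_neg hl0]
      by_cases hln : l = n
      · subst hln; simp [Nat.pos_of_ne_zero h0]
      · rw [if_neg hln, if_pos (by omega), if_pos (by omega)]

lemma ccoef_sum (ν σ : ℝ) (n : ℕ) (D : ℕ → ℝ) :
    ∑ s ∈ Finset.range (n + 1), ccoef ν σ n (n - s) * D s =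
      ∑ k ∈ Finset.range n, (acoef ν σ (n - k) * D k + bcoef ν σ (n - k) * (D (k + 1) - D k))
        + acoef ν σ 0 * D n := by
  have h1 : ∑ s ∈ Finset.range (n + 1), ccoef ν σ n (n - s) * D s
      = ∑ s ∈ Finset.range (n + 1), acoef ν σ (n - s) * D s
        + ∑ s ∈ Finset.range (n + 1), (if n - s < n then bcoef ν σ (n - s + 1) else 0) * D s
        - ∑ s ∈ Finset.range (n + 1), (if 0 < n - s then bcoef ν σ (n - s) else 0) * D s := by
    rw [← Finset.sum_add_distrib, ← Finset.sum_sub_distrib]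
    apply Finset.sum_congr rfl
    intro s _
    rw [ccoef_eq ν σ n (n - s) (by omega)]; ring
  rw [h1, Finset.sum_range_succ, Finset.sum_range_succ', Finset.sum_range_succ]
  have h2 : ∑ k ∈ Finset.range n,
      (if n - (k + 1) < n then bcoef ν σ (n - (k + 1) + 1) else 0) * D (k + 1)
      = ∑ k ∈ Finset.range n, bcoef ν σ (n - k) * D (k + 1) := by
    apply Finset.sum_congr rfl
    intro k hk
    have := Finset.mem_range.1 hk
    rw [if_pos (by omega), show n - (k + 1) + 1 = n - k by omega]
  have h3 : ∑ k ∈ Finset.range n, (if 0 < n - k then bcoef ν σ (n - k) else 0) * D k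
      = ∑ k ∈ Finset.range n, bcoef ν σ (n - k) * D k := by
    apply Finset.sum_congr rfl
    intro k hk
    have := Finset.mem_range.1 hk
    rw [if_pos (by omega)]
  rw [h2, h3]
  simp only [mul_sub, Finset.sum_add_distrib, Finset.sum_sub_distrib]
  simp
  ring

lemma coef_local (ν σ τ T p q d0 d1 : ℝ) (j : ℕ) (hν1 : ν < 1) (hσ : 0 < σ) (hτ : 0 < τ)
    (hq : q = p + τ) (hTq : T - q = ((j : ℝ) + σ) * τ) :
    d0 / τ * (∫ s in p..q, (T - s) ^ (-ν))
      + (d1 - d0) / τ ^ 2 * (∫ s in p..q, (s - (p + τ / 2)) * (T - s) ^ (-ν))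
    = τ ^ (-ν) / (1 - ν) * (acoef ν σ (j + 1) * d0 + bcoef ν σ (j + 1) * (d1 - d0)) := by
  have hA : 0 < (j : ℝ) + σ := by positivity
  have hTq' : 0 < T - q := by rw [hTq]; positivity
  rw [weight_int ν T p q hν1, weight_int1 ν T _ p q hν1 (by linarith) (by linarith)]
  have hTp : T - p = ((j : ℝ) + 1 + σ) * τ := by linarith
  have hTm : T - (p + τ / 2) = ((j : ℝ) + σ + 1 / 2) * τ := by linarith
  have hB : 0 < (j : ℝ) + 1 + σ := by positivity
  have e2 : ∀ x : ℝ, 0 < x → x ^ (2 - ν) = x * x ^ (1 - ν) := fun x hx => by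
    rw [show 2 - ν = 1 + (1 - ν) by ring, Real.rpow_add hx, Real.rpow_one]
  have e1 : τ ^ (1 - ν) = τ * τ ^ (-ν) := by
    rw [sub_eq_add_neg, Real.rpow_add hτ, Real.rpow_one]
  unfold bcoef
  simp only [acoef]
  rw [hTm, hTp, hTq]
  push_cast
  rw [show (j : ℝ) + 1 - 1 + σ = j + σ by ring]
  rw [Real.mul_rpow hB.le hτ.le, Real.mul_rpow hA.le hτ.le, Real.mul_rpow hB.le hτ.le,
    Real.mul_rpow hA.le hτ.le, e2 τ hτ, e1, e2 _ hA, e2 _ hB]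
  have h1 : (1 - ν) ≠ 0 := by linarith
  have h2 : (2 - ν) ≠ 0 := by linarith
  field_simp
  ring

lemma interior_local {L M : ℝ} {u f1 f2 : ℝ → ℝ} (H : Smooth3 L M u f1 f2) (ν τ T p q r : ℝ)
    (hν0 : 0 < ν) (hν1 : ν < 1) (hτ : 0 < τ) (hp : 0 ≤ p)
    (hq : q = p + τ) (hr : r = q + τ) (hrL : r ≤ L) (hqT : q < T) :
    |(∫ s in p..q, f1 s * (T - s) ^ (-ν))
      - ((u q - u p) / τ * (∫ s in p..q, (T - s) ^ (-ν))
        + ((u r - u q) - (u q - u p)) / τ ^ 2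
            * (∫ s in p..q, (s - (p + τ / 2)) * (T - s) ^ (-ν)))|
      ≤ 3 * M * τ ^ 3 * ((T - q) ^ (-ν) - (T - p) ^ (-ν)) := by
  have hM := H.hM
  have hpq : p ≤ q := by linarith
  have hqI : q ∈ Set.Icc 0 L := ⟨by linarith, by linarith⟩
  have hsub : Set.Icc p q ⊆ Set.Icc 0 L := Set.Icc_subset_Icc hp hqI.2
  set d0 := u q - u p with hd0
  set d1 := u r - u q with hd1
  have hf1c : ContinuousOn f1 (Set.Icc p q) := H.c1.mono hsub
  have hf1i : IntervalIntegrable f1 MeasureTheory.volume p q :=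
    ContinuousOn.intervalIntegrable_of_Icc hpq hf1c
  have t0 := H.taylor2 (p := p) (q := q) (c := q) (R := τ) hp hpq hqI.2 hqI
    (by linarith) (by linarith)
  have t1 := H.taylor2 (p := q) (q := r) (c := q) (R := τ) hqI.1 (by linarith) hrL hqI
    (by linarith) (by linarith)
  rw [← hd0, show q - p = τ by linarith, show p - q = -τ by linarith] at t0
  rw [← hd1, show r - q = τ by linarith] at t1
  have hbound := weighted_bound ν T p q (3 * M * τ ^ 2) hν0 hpq hqT
    (fun s => f1 s - (d0 / τ + (d1 - d0) / τ ^ 2 * (s - (p + τ / 2))))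
    (hf1c.sub (by fun_prop)) (fun s hs => by
      have ts := H.taylor1 (x := s) (c := q) (R := τ) (hsub hs) hqI
        (by rw [abs_le]; constructor <;> linarith [hs.1, hs.2])
      set e0 := d0 - f1 q * τ - f2 q * ((q - q) ^ 2 - (-τ) ^ 2) / 2 with he0
      set e1 := d1 - f1 q * τ - f2 q * (τ ^ 2 - (q - q) ^ 2) / 2 with he1
      set θ := (s - (p + τ / 2)) / τ with hθ
      have hθ1 : |θ| ≤ 1 / 2 := by
        rw [hθ, abs_div, abs_of_pos hτ, div_le_iff₀ hτ, abs_le]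
        constructor <;> linarith [hs.1, hs.2]
      have hid : f1 s - (d0 / τ + (d1 - d0) / τ ^ 2 * (s - (p + τ / 2)))
          = (f1 s - f1 q - f2 q * (s - q)) - (e0 / τ + (e1 - e0) / τ * θ) := by
        rw [he0, he1, hθ, hq]; field_simp; ring
      have b0 : |e0 / τ| ≤ M * τ ^ 2 := by
        rw [abs_div, abs_of_pos hτ, div_le_iff₀ hτ]; exact t0
      have b1 : |(e1 - e0) / τ| ≤ 2 * (M * τ ^ 2) := by
        rw [abs_div, abs_of_pos hτ, div_le_iff₀ hτ]
        exact (abs_sub _ _).trans (by linarith)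
      have b2 : |(e1 - e0) / τ * θ| ≤ 2 * (M * τ ^ 2) * (1 / 2) := by
        rw [abs_mul]; exact mul_le_mul b1 hθ1 (abs_nonneg _) (by positivity)
      rw [hid]
      refine (abs_sub _ _).trans ?_
      have := abs_add_le (e0 / τ) ((e1 - e0) / τ * θ)
      linarith)
    (by
      rw [intervalIntegral.integral_sub hf1i (by
        apply Continuous.intervalIntegrable; fun_prop)]
      have hftc : ∫ s in p..q, f1 s = u q - u p := by
        apply intervalIntegral.integral_eq_sub_of_hasDerivAt_of_le hpq (H.cu.mono hsub) _ hf1i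
        intro x hx
        exact H.du x ⟨by linarith [hx.1], by linarith [hx.2]⟩
      have hlin : ∫ s in p..q, (d0 / τ + (d1 - d0) / τ ^ 2 * (s - (p + τ / 2))) = d0 := by
        rw [intervalIntegral.integral_add (by simp) (by
          apply Continuous.intervalIntegrable; fun_prop),
          intervalIntegral.integral_const_mul,
          intervalIntegral.integral_sub (by simp) (by simp), integral_id]
        simp only [intervalIntegral.integral_const, smul_eq_mul]
        rw [hq]; field_simp; ring
      rw [hftc, hlin]; simp [hd0])
  have hwc : ContinuousOn (fun s => (T - s) ^ (-ν)) (Set.uIcc p q) := by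
    rw [Set.uIcc_of_le hpq]
    apply ContinuousOn.rpow_const (by fun_prop)
    intro s hs; left; linarith [hs.2]
  have hwi := weight_ii ν T p q hν1
  have hsplit : ∫ s in p..q, (f1 s - (d0 / τ + (d1 - d0) / τ ^ 2 * (s - (p + τ / 2))))
        * (T - s) ^ (-ν)
      = (∫ s in p..q, f1 s * (T - s) ^ (-ν))
      - (d0 / τ * (∫ s in p..q, (T - s) ^ (-ν))
        + (d1 - d0) / τ ^ 2 * (∫ s in p..q, (s - (p + τ / 2)) * (T - s) ^ (-ν))) := by
    rw [← intervalIntegral.integral_const_mul, ← intervalIntegral.integral_const_mul,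
      ← intervalIntegral.integral_add, ← intervalIntegral.integral_sub]
    · apply intervalIntegral.integral_congr; intro s _; simp only []; ring
    · exact hf1i.mul_continuousOn hwc
    · exact (hwi.const_mul _).add ((hwi.continuousOn_mul (by fun_prop)).const_mul _)
    · exact hwi.const_mul _
    · exact (hwi.continuousOn_mul (by fun_prop)).const_mul _
  rw [hsplit] at hbound
  refine hbound.trans (le_of_eq ?_)
  rw [hq]; ring

lemma last_local {L M : ℝ} {u f1 f2 : ℝ → ℝ} (H : Smooth3 L M u f1 f2) (ν τ T p q : ℝ)
    (hν0 : 0 < ν) (hν1 : ν < 1) (hτ : 0 < τ) (hp : 0 ≤ p)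
    (hq : q = p + τ) (hqL : q ≤ L) (hT : T = p + (1 - ν / 2) * τ) :
    |(∫ s in p..T, f1 s * (T - s) ^ (-ν))
      - τ ^ (-ν) / (1 - ν) * (acoef ν (1 - ν / 2) 0 * (u q - u p))|
      ≤ 2 * (1 - ν / 2) ^ (1 - ν) / (1 - ν) * M * τ ^ (3 - ν) := by
  have hM := H.hM
  have hσ : 0 < 1 - ν / 2 := by linarith
  have hpT : p ≤ T := by rw [hT]; nlinarith
  have hTq : T ≤ q := by rw [hT, hq]; nlinarith
  have hsub : Set.Icc p T ⊆ Set.Icc 0 L := Set.Icc_subset_Icc hp (hTq.trans hqL)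
  set c := p + τ / 2 with hc
  have hcI : c ∈ Set.Icc 0 L := ⟨by linarith, by linarith⟩
  have hwi := weight_ii ν T p T hν1
  have h1 : (1 - ν) ≠ 0 := by linarith
  have h2 : (2 - ν) ≠ 0 := by linarith
  have e1 : τ ^ (1 - ν) = τ * τ ^ (-ν) := by
    rw [sub_eq_add_neg, Real.rpow_add hτ, Real.rpow_one]
  have e3 : τ ^ (3 - ν) = τ ^ 3 * τ ^ (-ν) := by
    rw [sub_eq_add_neg, Real.rpow_add hτ]; norm_cast
  have e2 : ∀ x : ℝ, 0 < x → x ^ (2 - ν) = x * x ^ (1 - ν) := fun x hx => by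
    rw [show 2 - ν = 1 + (1 - ν) by ring, Real.rpow_add hx, Real.rpow_one]
  have hTp : T - p = (1 - ν / 2) * τ := by rw [hT]; ring
  have hTp0 : 0 < T - p := by rw [hTp]; positivity
  have hW : ∫ s in p..T, (T - s) ^ (-ν) = τ ^ (-ν) / (1 - ν) * ((1 - ν / 2) ^ (1 - ν) * τ) := by
    rw [weight_int ν T p T hν1, sub_self, Real.zero_rpow h1, hTp, Real.mul_rpow hσ.le hτ.le, e1]
    ring
  have hZ : ∫ s in p..T, (s - c) * (T - s) ^ (-ν) = 0 := by
    rw [weight_int1 ν T c p T hν1 hpT le_rfl, sub_self, Real.zero_rpow h1, Real.zero_rpow h2,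
      e2 _ hTp0, show T - c = (1 - ν) / 2 * τ by rw [hT, hc]; ring]
    simp only [sub_zero]
    generalize (T - p) ^ (1 - ν) = X
    rw [hTp]; field_simp; ring
  have t := H.taylor2 (p := p) (q := q) (c := c) (R := τ) hp (by linarith) hqL hcI
    (by linarith) (by linarith)
  set d := u q - u p with hd
  have ht : |d / τ - f1 c| ≤ M * τ ^ 2 := by
    have : d / τ - f1 c = (d - f1 c * (q - p) - f2 c * ((q - c) ^ 2 - (p - c) ^ 2) / 2) / τ := by
      rw [hc, hq]; field_simp; ring
    rw [this, abs_div, abs_of_pos hτ, div_le_iff₀ hτ]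
    rwa [show q - p = τ by linarith] at t ⊢
  have hf1c : ContinuousOn f1 (Set.uIcc p T) := by
    rw [Set.uIcc_of_le hpT]; exact H.c1.mono hsub
  have hsplit : (∫ s in p..T, f1 s * (T - s) ^ (-ν))
      - τ ^ (-ν) / (1 - ν) * (acoef ν (1 - ν / 2) 0 * d)
      = ∫ s in p..T, (f1 s - d / τ - f2 c * (s - c)) * (T - s) ^ (-ν) := by
    have : ∫ s in p..T, (f1 s - d / τ - f2 c * (s - c)) * (T - s) ^ (-ν)
        = (∫ s in p..T, f1 s * (T - s) ^ (-ν)) - d / τ * (∫ s in p..T, (T - s) ^ (-ν))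
          - f2 c * ∫ s in p..T, (s - c) * (T - s) ^ (-ν) := by
      rw [← intervalIntegral.integral_const_mul, ← intervalIntegral.integral_const_mul,
        ← intervalIntegral.integral_sub, ← intervalIntegral.integral_sub]
      · apply intervalIntegral.integral_congr; intro s _; simp only []; ring
      · exact (hwi.continuousOn_mul hf1c).sub (hwi.const_mul _)
      · exact (hwi.continuousOn_mul (by fun_prop)).const_mul _
      · exact (hwi.continuousOn_mul hf1c)
      · exact (hwi.const_mul _)
    rw [this, hZ, hW, acoef]
    field_simp
    ring
  rw [hsplit]
  have hb : |∫ s in p..T, (f1 s - d / τ - f2 c * (s - c)) * (T - s) ^ (-ν)|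
      ≤ ∫ s in p..T, (2 * M * τ ^ 2) * (T - s) ^ (-ν) := by
    rw [← Real.norm_eq_abs]
    apply intervalIntegral.norm_integral_le_of_norm_le hpT _ (hwi.const_mul _)
    refine Filter.Eventually.of_forall (fun s hs => ?_)
    have hs' : s ∈ Set.Icc p T := ⟨hs.1.le, hs.2⟩
    have hw : 0 ≤ (T - s) ^ (-ν) := Real.rpow_nonneg (by linarith [hs.2]) _
    rw [norm_mul, Real.norm_eq_abs, Real.norm_eq_abs, abs_of_nonneg hw]
    apply mul_le_mul_of_nonneg_right _ hw
    have ts := H.taylor1 (x := s) (c := c) (R := τ) (hsub hs') hcI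
      (by rw [abs_le]; constructor <;> linarith [hs.1, hs.2])
    rw [show f1 s - d / τ - f2 c * (s - c)
      = (f1 s - f1 c - f2 c * (s - c)) - (d / τ - f1 c) by ring]
    exact (abs_sub _ _).trans (by linarith)
  rw [intervalIntegral.integral_const_mul, hW] at hb
  refine hb.trans (le_of_eq ?_)
  rw [e3]; ring

lemma core {M : ℝ} {u f1 f2 : ℝ → ℝ} (ν τ : ℝ) (n : ℕ)
    (hν0 : 0 < ν) (hν1 : ν < 1) (hτ : 0 < τ)
    (H : Smooth3 (((n : ℝ) + 1) * τ) M u f1 f2) :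
    |(∫ s in (0 : ℝ)..(((n : ℝ) + (1 - ν / 2)) * τ),
          f1 s * (((n : ℝ) + (1 - ν / 2)) * τ - s) ^ (-ν))
      - τ ^ (-ν) / (1 - ν) * ∑ s ∈ Finset.range (n + 1), ccoef ν (1 - ν / 2) n (n - s)
          * (u (((s + 1 : ℕ) : ℝ) * τ) - u ((s : ℝ) * τ))|
      ≤ (3 * (1 - ν / 2) ^ (-ν) + 2 * (1 - ν / 2) ^ (1 - ν) / (1 - ν)) * M * τ ^ (3 - ν) := by
  have hM := H.hM
  have hσ : 0 < 1 - ν / 2 := by linarith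
  set T := ((n : ℝ) + (1 - ν / 2)) * τ with hT
  have hTL : T ≤ ((n : ℝ) + 1) * τ := by
    rw [hT]; apply mul_le_mul_of_nonneg_right _ hτ.le; linarith
  have hT0 : 0 ≤ T := by positivity
  have hint : ∀ a b : ℝ, a ∈ Set.Icc 0 T → b ∈ Set.Icc 0 T →
      IntervalIntegrable (fun s => f1 s * (T - s) ^ (-ν)) MeasureTheory.volume a b := by
    intro a b ha hb
    apply (weight_ii ν T a b hν1).continuousOn_mul
    apply H.c1.mono
    exact (Set.uIcc_subset_Icc ha hb).trans (Set.Icc_subset_Icc le_rfl hTL)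
  have hmem : ∀ k : ℕ, k ≤ n → (k : ℝ) * τ ∈ Set.Icc 0 T := by
    intro k hk
    have : (k : ℝ) ≤ n := by exact_mod_cast hk
    exact ⟨by positivity, by rw [hT]; apply mul_le_mul_of_nonneg_right _ hτ.le; linarith⟩
  have hsum := intervalIntegral.sum_integral_adjacent_intervals (μ := MeasureTheory.volume)
    (f := fun s => f1 s * (T - s) ^ (-ν)) (a := fun k : ℕ => (k : ℝ) * τ) (n := n)
    (fun k hk => hint _ _ (hmem k hk.le) (hmem (k + 1) hk))
  have hadd := intervalIntegral.integral_add_adjacent_intervals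
    (hint 0 ((n : ℝ) * τ) ⟨le_rfl, hT0⟩ (hmem n le_rfl))
    (hint ((n : ℝ) * τ) T (hmem n le_rfl) ⟨hT0, le_rfl⟩)
  simp only [Nat.cast_zero, zero_mul] at hsum
  rw [← hadd, ← hsum, ccoef_sum ν (1 - ν / 2) n
    (fun s => u (((s + 1 : ℕ) : ℝ) * τ) - u ((s : ℝ) * τ)), mul_add, Finset.mul_sum]
  have hlast := last_local H ν τ T ((n : ℝ) * τ) (((n + 1 : ℕ) : ℝ) * τ) hν0 hν1 hτ
    (by positivity) (by push_cast; ring) (by push_cast; exact le_rfl) (by rw [hT]; ring)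
  have hin : ∀ k ∈ Finset.range n,
      |(∫ s in ((k : ℝ) * τ)..(((k + 1 : ℕ) : ℝ) * τ), f1 s * (T - s) ^ (-ν))
        - τ ^ (-ν) / (1 - ν) * (acoef ν (1 - ν / 2) (n - k)
            * (u (((k + 1 : ℕ) : ℝ) * τ) - u ((k : ℝ) * τ))
          + bcoef ν (1 - ν / 2) (n - k) * ((u (((k + 1 + 1 : ℕ) : ℝ) * τ)
            - u (((k + 1 : ℕ) : ℝ) * τ)) - (u (((k + 1 : ℕ) : ℝ) * τ) - u ((k : ℝ) * τ))))|
      ≤ 3 * M * τ ^ 3 * ((T - ((k + 1 : ℕ) : ℝ) * τ) ^ (-ν) - (T - (k : ℝ) * τ) ^ (-ν)) := by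
    intro k hk
    obtain ⟨j, rfl⟩ : ∃ j, n = k + 1 + j := ⟨n - (k + 1), by have := Finset.mem_range.1 hk; omega⟩
    rw [show k + 1 + j - k = j + 1 by omega]
    have hTq : T - ((k + 1 : ℕ) : ℝ) * τ = ((j : ℝ) + (1 - ν / 2)) * τ := by
      rw [hT]; push_cast; ring
    rw [← coef_local ν (1 - ν / 2) τ T ((k : ℝ) * τ) (((k + 1 : ℕ) : ℝ) * τ) _ _ j hν1 hσ hτ
      (by push_cast; ring) hTq]
    apply interior_local H ν τ T _ _ _ hν0 hν1 hτ (by positivity) (by push_cast; ring)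
      (by push_cast; ring)
    · apply mul_le_mul_of_nonneg_right _ hτ.le
      push_cast
      have : (0 : ℝ) ≤ j := by positivity
      linarith
    · have : 0 < T - ((k + 1 : ℕ) : ℝ) * τ := by rw [hTq]; positivity
      linarith
  have hS := (Finset.abs_sum_le_sum_abs _ _).trans (Finset.sum_le_sum hin)
  rw [← Finset.mul_sum, Finset.sum_range_sub (fun k : ℕ => (T - (k : ℝ) * τ) ^ (-ν)) n,
    Finset.sum_sub_distrib] at hS
  have hTn : T - (n : ℝ) * τ = (1 - ν / 2) * τ := by rw [hT]; ring
  have e3 : τ ^ (3 - ν) = τ ^ 3 * τ ^ (-ν) := by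
    rw [sub_eq_add_neg, Real.rpow_add hτ]; norm_cast
  have hS2 : 3 * M * τ ^ 3 * ((T - (n : ℝ) * τ) ^ (-ν) - (T - ((0 : ℕ) : ℝ) * τ) ^ (-ν))
      ≤ 3 * (1 - ν / 2) ^ (-ν) * M * τ ^ (3 - ν) := by
    have h0 : 0 ≤ (T - ((0 : ℕ) : ℝ) * τ) ^ (-ν) := Real.rpow_nonneg (by simpa using hT0) _
    calc _ ≤ 3 * M * τ ^ 3 * (T - (n : ℝ) * τ) ^ (-ν) := by gcongr; linarith
      _ = _ := by rw [hTn, Real.mul_rpow hσ.le hτ.le, e3]; ring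
  have hS3 := hS.trans hS2
  rw [add_sub_add_comm]
  refine (abs_add_le _ _).trans ?_
  rw [add_mul, add_mul]
  exact add_le_add hS3 hlast

lemma smooth3_of_contDiffOn (L : ℝ) (hL : 0 < L) (u : ℝ → ℝ)
    (hu : ContDiffOn ℝ 3 u (Set.Icc 0 L)) :
    Smooth3 L (⨆ t : Set.Icc (0 : ℝ) L, |iteratedDeriv 3 u (t : ℝ)|) u
      (iteratedDerivWithin 1 u (Set.Icc 0 L)) (iteratedDerivWithin 2 u (Set.Icc 0 L)) := by
  have hU : UniqueDiffOn ℝ (Set.Icc 0 L) := uniqueDiffOn_Icc hL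
  have hstep : ∀ m : ℕ, m < 3 → ∀ x ∈ Set.Ioo 0 L,
      HasDerivAt (iteratedDerivWithin m u (Set.Icc 0 L))
        (iteratedDerivWithin (m + 1) u (Set.Icc 0 L) x) x := by
    intro m hm x hx
    have h1 := (hu.differentiableOn_iteratedDerivWithin (m := m) (by exact_mod_cast hm) hU) x
      ⟨hx.1.le, hx.2.le⟩
    have h2 := h1.hasDerivWithinAt
    rw [← iteratedDerivWithin_succ] at h2
    exact h2.hasDerivAt (Icc_mem_nhds hx.1 hx.2)
  have heq : ∀ x ∈ Set.Ioo 0 L,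
      iteratedDerivWithin 3 u (Set.Icc 0 L) x = iteratedDeriv 3 u x := by
    intro x hx
    apply iteratedDerivWithin_eq_iteratedDeriv hU _ ⟨hx.1.le, hx.2.le⟩
    exact hu.contDiffAt (Icc_mem_nhds hx.1 hx.2)
  have hc3 := hu.continuousOn_iteratedDerivWithin (m := 3) (by norm_cast) hU
  obtain ⟨K, hK⟩ := isCompact_Icc.exists_bound_of_continuousOn hc3
  have hbdd : BddAbove (Set.range fun t : Set.Icc (0 : ℝ) L => |iteratedDeriv 3 u (t : ℝ)|) := by
    refine ⟨max K (max |iteratedDeriv 3 u 0| |iteratedDeriv 3 u L|), ?_⟩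
    rintro _ ⟨⟨t, ht⟩, rfl⟩
    simp only
    rcases ht.1.eq_or_lt with h | h
    · rw [← h]; exact (le_max_left _ _).trans (le_max_right _ _)
    rcases ht.2.eq_or_lt with h' | h'
    · rw [h']; exact (le_max_right _ _).trans (le_max_right _ _)
    · rw [← heq t ⟨h, h'⟩]; exact (hK t ht).trans (le_max_left _ _)
  refine ⟨hu.continuousOn, hu.continuousOn_iteratedDerivWithin (by norm_cast) hU,
    hu.continuousOn_iteratedDerivWithin (by norm_cast) hU, ?_, hstep 1 (by norm_num), ?_, ?_⟩
  · intro x hx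
    have := hstep 0 (by norm_num) x hx
    rwa [iteratedDerivWithin_zero] at this
  · intro x hx
    refine ⟨_, hstep 2 (by norm_num) x hx, ?_⟩
    rw [show 2 + 1 = 3 from rfl, heq x hx]
    exact le_ciSup hbdd (⟨x, hx.1.le, hx.2.le⟩ : Set.Icc (0 : ℝ) L)
  · exact Real.iSup_nonneg (fun _ => abs_nonneg _)

/-- For `0 < ν < 1`, `σ = 1 − ν/2`, there exists `C` depending only on `ν`
such that for every `τ > 0`, every `n ≥ 0` and every `u ∈ C³[0, t_{n+1}]`:
`|∂₀ₜ^ν u(t_{n+σ}) − Δ₀ₜ_{n+σ}^ν u| ≤ C·(max_{0≤t≤t_{n+1}}|u'''(t)|)·τ^{3−ν}`. -/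
theorem L21sigma_approximation_error (ν : ℝ) (hν0 : 0 < ν) (hν1 : ν < 1) :
    ∃ C > 0, ∀ τ : ℝ, 0 < τ → ∀ (n : ℕ) (u : ℝ → ℝ),
      ContDiffOn ℝ 3 u (Set.Icc (0 : ℝ) (((n : ℝ) + 1) * τ)) →
      |caputoDeriv ν u (((n : ℝ) + (1 - ν / 2)) * τ)
          - discFracDeriv ν (1 - ν / 2) τ n (fun s => u ((s : ℝ) * τ))|
        ≤ C * (⨆ t : Set.Icc (0 : ℝ) (((n : ℝ) + 1) * τ), |iteratedDeriv 3 u (t : ℝ)|)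
            * τ ^ (3 - ν) := by
  have hσ : 0 < 1 - ν / 2 := by linarith
  have h1 : 0 < 1 - ν := by linarith
  have hG : 0 < Real.Gamma (1 - ν) := Real.Gamma_pos_of_pos h1
  refine ⟨1 / Real.Gamma (1 - ν) *
    (3 * (1 - ν / 2) ^ (-ν) + 2 * (1 - ν / 2) ^ (1 - ν) / (1 - ν)), by positivity, ?_⟩
  intro τ hτ n u hu
  have hL : 0 < ((n : ℝ) + 1) * τ := by positivity
  have H := smooth3_of_contDiffOn _ hL u hu
  have hcore := core ν τ n hν0 hν1 hτ H
  have hTL : ((n : ℝ) + (1 - ν / 2)) * τ ≤ ((n : ℝ) + 1) * τ := by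
    apply mul_le_mul_of_nonneg_right _ hτ.le; linarith
  have hT0 : 0 < ((n : ℝ) + (1 - ν / 2)) * τ := by positivity
  have hTL' : ((n : ℝ) + (1 - ν / 2)) * τ < ((n : ℝ) + 1) * τ := by
    apply mul_lt_mul_of_pos_right _ hτ; linarith
  have hI : ∫ s in (0 : ℝ)..(((n : ℝ) + (1 - ν / 2)) * τ),
        deriv u s * (((n : ℝ) + (1 - ν / 2)) * τ - s) ^ (-ν)
      = ∫ s in (0 : ℝ)..(((n : ℝ) + (1 - ν / 2)) * τ),
        iteratedDerivWithin 1 u (Set.Icc 0 (((n : ℝ) + 1) * τ)) s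
          * (((n : ℝ) + (1 - ν / 2)) * τ - s) ^ (-ν) := by
    apply intervalIntegral.integral_congr_ae
    refine Filter.Eventually.of_forall (fun s hs => ?_)
    rw [Set.uIoc_of_le hT0.le] at hs
    rw [(H.du s ⟨hs.1, hs.2.trans_lt hTL'⟩).deriv]
  have hG2 : Real.Gamma (2 - ν) = (1 - ν) * Real.Gamma (1 - ν) := by
    rw [← Real.Gamma_add_one h1.ne']; congr 1; ring
  unfold caputoDeriv discFracDeriv
  rw [hI, hG2]
  have hfac : ∀ A S : ℝ, 1 / Real.Gamma (1 - ν) * A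
      - τ ^ (-ν) / ((1 - ν) * Real.Gamma (1 - ν)) * S
      = 1 / Real.Gamma (1 - ν) * (A - τ ^ (-ν) / (1 - ν) * S) := by
    intro A S
    have := h1.ne'
    field_simp
  rw [hfac, abs_mul, abs_of_pos (by positivity : 0 < 1 / Real.Gamma (1 - ν)), mul_assoc, mul_assoc]
  refine mul_le_mul_of_nonneg_left ?_ (by positivity)
  rw [← mul_assoc]
  exact hcore
end

section
/- Let u be a solution of: ∂₀ₜ^ν u = (k(x,t)u_x)_x + f(x,t) on (0,1)×(0,T], u(0,t)=α·u(1,t), k(1,t)u_x(1,t)=β·k(0,t)u_x(0,t)+γ·u(1,t)+μ(t), u(x,0)=u₀(x), where k(x,t)=k(1−x,t) for all (x,t). Let δ be a real number with δ∉{1,−1,−α,β}. Then v(x,t)=δ·u(x,t)+u(1−x,t) solves: ∂₀ₜ^ν v = (k(x,t)v_x)_x + f₁(x,t) on (0,1)×(0,T], v(0,t)=α₁·v(1,t), k(1,t)v_x(1,t)=β₁·k(0,t)v_x(0,t)+γ₁·v(1,t)+μ₁(t), v(x,0)=δ·u₀(x)+u₀(1−x), where α₁=(δα+1)/(δ+α),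 β₁=(δβ−1)/(δ−β), γ₁=γ(δ²−1)/((δ+α)(δ−β)), μ₁(t)=((δ²−1)/(δ−β))μ(t), and f₁(x,t)=δ·f(x,t)+f(1−x,t). -/
open MeasureTheory

/-- The Caputo fractional derivative in time of `u(x,·)`:
`∂₀ₜ^ν u(x,t) = (1/Γ(1−ν)) ∫₀ᵗ u_s(x,s)(t−s)^{−ν} ds`. -/
noncomputable def caputoT (ν : ℝ) (u : ℝ → ℝ → ℝ) (x t : ℝ) : ℝ :=
  (1 / Real.Gamma (1 - ν)) * ∫ s in (0 : ℝ)..t, deriv (fun r => u x r) s * (t - s) ^ (-ν)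

/-- If `u` solves the nonlocal problem with parameters `(α,β,γ)`, data `f`,
`μ`, `u₀` and a symmetric coefficient `k(x,t) = k(1−x,t)`, and `δ ∉ {1,−1,−α,β}`, then
`v(x,t) = δ·u(x,t) + u(1−x,t)` solves the problem of the same form with parameters
`α₁ = (δα+1)/(δ+α)`, `β₁ = (δβ−1)/(δ−β)`, `γ₁ = γ(δ²−1)/((δ+α)(δ−β))`, data
`f₁(x,t) = δf(x,t) + f(1−x,t)`, `μ₁(t) = ((δ²−1)/(δ−β))μ(t)` and initial values
`v(x,0) = δu₀(x) + u₀(1−x)`. -/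
theorem reflection_transforms_problem (ν T c₁ c₂ α β γ δ : ℝ)
    (hν0 : 0 < ν) (hν1 : ν < 1) (hT : 0 < T) (hc₁ : 0 < c₁)
    (hδ1 : δ ≠ 1) (hδ2 : δ ≠ -1) (hδ3 : δ ≠ -α) (hδ4 : δ ≠ β)
    (k f u : ℝ → ℝ → ℝ) (μ u₀ : ℝ → ℝ)
    (hk : ∀ x ∈ Set.Icc (0 : ℝ) 1, ∀ t ∈ Set.Icc (0 : ℝ) T, c₁ ≤ k x t ∧ k x t ≤ c₂)
    (hksym : ∀ x ∈ Set.Icc (0 : ℝ) 1, ∀ t ∈ Set.Icc (0 : ℝ) T, k x t = k (1 - x) t)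
    (hksmooth : ContDiff ℝ 1 fun p : ℝ × ℝ => k p.1 p.2)
    (husmooth : ContDiff ℝ 2 fun p : ℝ × ℝ => u p.1 p.2)
    (hpde : ∀ x ∈ Set.Ioo (0 : ℝ) 1, ∀ t ∈ Set.Ioc (0 : ℝ) T,
      caputoT ν u x t
        = deriv (fun y => k y t * deriv (fun z => u z t) y) x + f x t)
    (hbc1 : ∀ t ∈ Set.Icc (0 : ℝ) T, u 0 t = α * u 1 t)
    (hbc2 : ∀ t ∈ Set.Icc (0 : ℝ) T,
      k 1 t * deriv (fun z => u z t) 1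
        = β * (k 0 t * deriv (fun z => u z t) 0) + γ * u 1 t + μ t)
    (hic : ∀ x ∈ Set.Icc (0 : ℝ) 1, u x 0 = u₀ x) :
    let v : ℝ → ℝ → ℝ := fun x t => δ * u x t + u (1 - x) t
    (∀ x ∈ Set.Ioo (0 : ℝ) 1, ∀ t ∈ Set.Ioc (0 : ℝ) T,
      caputoT ν v x t
        = deriv (fun y => k y t * deriv (fun z => v z t) y) x
          + (δ * f x t + f (1 - x) t)) ∧
    (∀ t ∈ Set.Icc (0 : ℝ) T, v 0 t = ((δ * α + 1) / (δ + α)) * v 1 t) ∧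
    (∀ t ∈ Set.Icc (0 : ℝ) T,
      k 1 t * deriv (fun z => v z t) 1
        = ((δ * β - 1) / (δ - β)) * (k 0 t * deriv (fun z => v z t) 0)
          + (γ * (δ ^ 2 - 1) / ((δ + α) * (δ - β))) * v 1 t
          + ((δ ^ 2 - 1) / (δ - β)) * μ t) ∧
    (∀ x ∈ Set.Icc (0 : ℝ) 1, v x 0 = δ * u₀ x + u₀ (1 - x)) := by
  intro v
  have hux : ∀ t, ContDiff ℝ 2 (fun z => u z t) := fun t =>
    husmooth.comp (contDiff_id.prodMk contDiff_const)
  have hut : ∀ x, ContDiff ℝ 2 (fun r => u x r) := fun x =>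
    husmooth.comp (contDiff_const.prodMk contDiff_id)
  have hkx : ∀ t, ContDiff ℝ 1 (fun z => k z t) := fun t =>
    hksmooth.comp (contDiff_id.prodMk contDiff_const)
  have hud : ∀ t, Differentiable ℝ (fun z => u z t) := fun t =>
    (hux t).differentiable (by norm_num)
  have hutd : ∀ x, Differentiable ℝ (fun r => u x r) := fun x =>
    (hut x).differentiable (by norm_num)
  have hrefl : ∀ (g : ℝ → ℝ) (y : ℝ), Differentiable ℝ g →
      HasDerivAt (fun z => g (1 - z)) (-deriv g (1 - y)) y := by
    intro g y hg
    have h1 : HasDerivAt (fun z : ℝ => 1 - z) (-1) y := by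
      simpa using (hasDerivAt_id y).const_sub 1
    have h2 := (hg (1 - y)).hasDerivAt.comp y h1
    simpa [Function.comp_def] using h2
  have hvx : ∀ t y, deriv (fun z => v z t) y
      = δ * deriv (fun z => u z t) y - deriv (fun z => u z t) (1 - y) := by
    intro t y
    have h := ((hud t y).hasDerivAt.const_mul δ).add (hrefl _ y (hud t))
    rw [sub_eq_add_neg]
    exact h.deriv
  have hA : δ + α ≠ 0 := fun h => hδ3 (by linarith)
  have hB : δ - β ≠ 0 := sub_ne_zero.mpr hδ4
  refine ⟨?_, ?_, ?_, ?_⟩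
  · intro x hx t ht
    have htI : t ∈ Set.Icc (0 : ℝ) T := ⟨ht.1.le, ht.2⟩
    have hx' : 1 - x ∈ Set.Ioo (0 : ℝ) 1 := ⟨by linarith [hx.2], by linarith [hx.1]⟩
    have hW : Differentiable ℝ (fun y => k y t * deriv (fun z => u z t) y) := by
      apply Differentiable.mul
      · exact (hkx t).differentiable (by norm_num)
      · have h2 : ContDiff ℝ (1 + 1) (fun z => u z t) := by
          have := hux t
          norm_num
          exact this
        exact (contDiff_succ_iff_deriv.mp h2).2.2.differentiable (by norm_num)
    have hderiv : deriv (fun y => k y t * deriv (fun z => v z t) y) x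
        = δ * deriv (fun y => k y t * deriv (fun z => u z t) y) x
          + deriv (fun y => k y t * deriv (fun z => u z t) y) (1 - x) := by
      have hev : (fun y => k y t * deriv (fun z => v z t) y) =ᶠ[nhds x]
          (fun y => δ * (k y t * deriv (fun z => u z t) y)
            - k (1 - y) t * deriv (fun z => u z t) (1 - y)) := by
        filter_upwards [Ioo_mem_nhds hx.1 hx.2] with y hy
        rw [hvx, ← hksym y ⟨hy.1.le, hy.2.le⟩ t htI]
        ring
      rw [hev.deriv_eq]
      have h := ((hW x).hasDerivAt.const_mul δ).sub (hrefl _ x hW)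
      rw [sub_neg_eq_add] at h
      exact h.deriv
    have hint : ∀ y, IntervalIntegrable
        (fun s => deriv (fun r => u y r) s * (t - s) ^ (-ν)) volume 0 t := by
      intro y
      have h0 : IntervalIntegrable (fun s : ℝ => s ^ (-ν)) volume 0 t :=
        intervalIntegral.intervalIntegrable_rpow' (by linarith)
      have h1 := (h0.comp_sub_left t).symm
      simp only [sub_zero, sub_self] at h1
      exact h1.continuousOn_mul ((hut y).continuous_deriv (by norm_num)).continuousOn
    have hcap : caputoT ν v x t = δ * caputoT ν u x t + caputoT ν u (1 - x) t := by
      have hd : ∀ s, deriv (fun r => v x r) s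
          = δ * deriv (fun r => u x r) s + deriv (fun r => u (1 - x) r) s := fun s =>
        (((hutd x s).hasDerivAt.const_mul δ).add (hutd (1 - x) s).hasDerivAt).deriv
      unfold caputoT
      have he : (fun s => deriv (fun r => v x r) s * (t - s) ^ (-ν))
          = fun s => δ * (deriv (fun r => u x r) s * (t - s) ^ (-ν))
            + deriv (fun r => u (1 - x) r) s * (t - s) ^ (-ν) := by
        funext s
        rw [hd]
        ring
      rw [he, intervalIntegral.integral_add ((hint x).const_mul δ) (hint (1 - x)),
        intervalIntegral.integral_const_mul]
      ring
    rw [hcap, hderiv, hpde x hx t ht, hpde (1 - x) hx' t ht]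
    ring
  · intro t ht
    simp only [v, sub_zero, sub_self]
    rw [hbc1 t ht]
    field_simp
    try ring
  · intro t ht
    have hk01 : k 0 t = k 1 t := by
      simpa using hksym 0 (by simp) t ht
    have h2 := hbc2 t ht
    rw [hvx, hvx]
    simp only [v, sub_zero, sub_self]
    rw [hbc1 t ht]
    rw [hk01] at h2 ⊢
    have hμ : μ t = k 1 t * deriv (fun z => u z t) 1
        - β * (k 1 t * deriv (fun z => u z t) 0) - γ * u 1 t := by linarith
    rw [hμ]
    field_simp
    ring
  · intro x hx
    simp only [v]
    rw [hic x hx, hic (1 - x) ⟨by linarith [hx.2], by linarith [hx.1]⟩]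
end

section
/- Let α, β be real numbers with |α|<1, |β|<1 and α≠β, and set δ₁ = (αβ−1−√((1−α²)(1−β²)))/(α−β). Then δ₁∉{1,−1,−α,β}, and (δ₁²−1)/((δ₁+α)(δ₁−β)) = ((√(1−α²)+√(1−β²))² + (α−β)²)/(√(1−α²)+√(1−β²))² > 0. Consequently, for any real γ, γ(δ₁²−1)/((δ₁+α)(δ₁−β)) ≤ 0 if and only if γ ≤ 0. -/
/-- For `|α| < 1`, `|β| < 1`, `α ≠ β` and
`δ₁ = (αβ−1−√((1−α²)(1−β²)))/(α−β)`, one has `δ₁ ∉ {1, −1, −α, β}`,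
`(δ₁²−1)/((δ₁+α)(δ₁−β)) = ((√(1−α²)+√(1−β²))² + (α−β)²)/(√(1−α²)+√(1−β²))² > 0`,
and hence for any real `γ`, `γ(δ₁²−1)/((δ₁+α)(δ₁−β)) ≤ 0 ↔ γ ≤ 0`. -/
theorem gamma_condition_case_abs_lt_one (α β : ℝ) (hα : |α| < 1) (hβ : |β| < 1)
    (hαβ : α ≠ β) :
    let δ₁ := (α * β - 1 - Real.sqrt ((1 - α ^ 2) * (1 - β ^ 2))) / (α - β)
    δ₁ ≠ 1 ∧ δ₁ ≠ -1 ∧ δ₁ ≠ -α ∧ δ₁ ≠ β ∧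
    (δ₁ ^ 2 - 1) / ((δ₁ + α) * (δ₁ - β))
      = ((Real.sqrt (1 - α ^ 2) + Real.sqrt (1 - β ^ 2)) ^ 2 + (α - β) ^ 2)
          / (Real.sqrt (1 - α ^ 2) + Real.sqrt (1 - β ^ 2)) ^ 2 ∧
    (δ₁ ^ 2 - 1) / ((δ₁ + α) * (δ₁ - β)) > 0 ∧
    ∀ γ : ℝ, γ * (δ₁ ^ 2 - 1) / ((δ₁ + α) * (δ₁ - β)) ≤ 0 ↔ γ ≤ 0 := by
  intro δ₁
  have h1 : 0 < 1 - α ^ 2 := by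
    have := (sq_lt_one_iff_abs_lt_one α).2 hα
    linarith
  have h2 : 0 < 1 - β ^ 2 := by
    have := (sq_lt_one_iff_abs_lt_one β).2 hβ
    linarith
  have hD : α - β ≠ 0 := sub_ne_zero.2 hαβ
  have hδ : δ₁ * (α - β) = α * β - 1 - Real.sqrt (1 - α ^ 2) * Real.sqrt (1 - β ^ 2) := by
    rw [← Real.sqrt_mul h1.le]
    exact div_mul_cancel₀ _ hD
  have ha := Real.sqrt_pos.2 h1
  have hb := Real.sqrt_pos.2 h2
  have ha2 := Real.sq_sqrt h1.le
  have hb2 := Real.sq_sqrt h2.le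
  clear_value δ₁
  generalize Real.sqrt (1 - α ^ 2) = a at *
  generalize Real.sqrt (1 - β ^ 2) = b at *
  have hab : 0 < a * b := mul_pos ha hb
  have hD2 : 0 < (α - β) ^ 2 := by positivity
  have e1 : (δ₁ + α) * (α - β) = -(a * (a + b)) := by linear_combination hδ + ha2
  have e2 : (δ₁ - β) * (α - β) = -(b * (a + b)) := by linear_combination hδ + hb2
  have e3 : (δ₁ ^ 2 - 1) * (α - β) ^ 2 = a * b * ((a + b) ^ 2 + (α - β) ^ 2) := by
    have hδ2 : (δ₁ * (α - β)) ^ 2 = (α * β - 1 - a * b) ^ 2 := by rw [hδ]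
    have hp : a ^ 2 * b ^ 2 = (1 - α ^ 2) * (1 - β ^ 2) := by rw [ha2, hb2]
    linear_combination hδ2 - hp - a * b * ha2 - a * b * hb2
  have e4 : ((δ₁ + α) * (δ₁ - β)) * (α - β) ^ 2 = a * b * (a + b) ^ 2 := by
    linear_combination (δ₁ - β) * (α - β) * e1 - a * (a + b) * e2
  have p3 : 0 < δ₁ ^ 2 - 1 := by
    refine pos_of_mul_pos_left (b := (α - β) ^ 2) ?_ hD2.le
    rw [e3]; positivity
  have p4 : 0 < (δ₁ + α) * (δ₁ - β) := by
    refine pos_of_mul_pos_left (b := (α - β) ^ 2) ?_ hD2.le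
    rw [e4]; positivity
  have pr : 0 < (δ₁ ^ 2 - 1) / ((δ₁ + α) * (δ₁ - β)) := div_pos p3 p4
  refine ⟨?_, ?_, ?_, ?_, ?_, pr, ?_⟩
  · rintro rfl; norm_num at p3
  · rintro rfl; norm_num at p3
  · rintro rfl; simp at p4
  · rintro rfl; simp at p4
  · rw [← mul_div_mul_right _ _ hD2.ne', e3, e4, mul_div_mul_left _ _ hab.ne']
  · intro γ
    rw [mul_div_assoc]
    constructor
    · intro h
      by_contra! hc
      exact absurd (mul_pos hc pr) (not_lt.2 h)
    · intro h
      exact mul_nonpos_of_nonpos_of_nonneg h pr.le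
end

section
/- Let α, β be real numbers with |α|>1, |β|>1 and α≠β, and set δ₂ = (αβ−1+√((α²−1)(β²−1)))/(α−β). Then δ₂∉{1,−1,−α,β}, and γ(δ₂²−1)/((δ₂+α)(δ₂−β)) = γ·((√(α²−1)+√(β²−1))² − (α−β)²)/(√(α²−1)+√(β²−1))². Consequently, for any real γ, γ(δ₂²−1)/((δ₂+α)(δ₂−β)) ≤ 0 if and only if αβγ ≤ 0. -/
theorem sign_pos_aux (x y g : ℝ) (hx : 0 < x) (hy : 0 < y) : g * x ≤ 0 ↔ y * g ≤ 0 := by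
  constructor
  · intro h
    have hg : g ≤ 0 := by
      by_contra! hg
      linarith [mul_pos hg hx]
    exact mul_nonpos_of_nonneg_of_nonpos hy.le hg
  · intro h
    have hg : g ≤ 0 := by
      by_contra! hg
      linarith [mul_pos hy hg]
    exact mul_nonpos_of_nonpos_of_nonneg hg hx.le

theorem sign_neg_aux (x y g : ℝ) (hx : x < 0) (hy : y < 0) : g * x ≤ 0 ↔ y * g ≤ 0 := by
  have := sign_pos_aux (-x) (-y) (-g) (by linarith) (by linarith)
  simpa using this

/-- For `|α| > 1`, `|β| > 1`, `α ≠ β` and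
`δ₂ = (αβ−1+√((α²−1)(β²−1)))/(α−β)`, one has `δ₂ ∉ {1, −1, −α, β}`,
`γ(δ₂²−1)/((δ₂+α)(δ₂−β)) = γ((√(α²−1)+√(β²−1))² − (α−β)²)/(√(α²−1)+√(β²−1))²`,
and hence for any real `γ`, `γ(δ₂²−1)/((δ₂+α)(δ₂−β)) ≤ 0 ↔ αβγ ≤ 0`. -/
theorem gamma_condition_case_abs_gt_one (α β : ℝ) (hα : |α| > 1) (hβ : |β| > 1)
    (hαβ : α ≠ β) :
    let δ₂ := (α * β - 1 + Real.sqrt ((α ^ 2 - 1) * (β ^ 2 - 1))) / (α - β)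
    δ₂ ≠ 1 ∧ δ₂ ≠ -1 ∧ δ₂ ≠ -α ∧ δ₂ ≠ β ∧
    (∀ γ : ℝ, γ * (δ₂ ^ 2 - 1) / ((δ₂ + α) * (δ₂ - β))
      = γ * ((Real.sqrt (α ^ 2 - 1) + Real.sqrt (β ^ 2 - 1)) ^ 2 - (α - β) ^ 2)
          / (Real.sqrt (α ^ 2 - 1) + Real.sqrt (β ^ 2 - 1)) ^ 2) ∧
    ∀ γ : ℝ, γ * (δ₂ ^ 2 - 1) / ((δ₂ + α) * (δ₂ - β)) ≤ 0 ↔ α * β * γ ≤ 0 := by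
  intro δ
  have hα2 : 1 < α ^ 2 := by
    rw [← sq_abs]; nlinarith
  have hβ2 : 1 < β ^ 2 := by
    rw [← sq_abs]; nlinarith
  have hab1 : 1 < |α * β| := by
    rw [abs_mul]; nlinarith
  have hδ : δ = (α * β - 1 + Real.sqrt ((α ^ 2 - 1) * (β ^ 2 - 1))) / (α - β) := rfl
  clear_value δ
  rw [Real.sqrt_mul (by linarith)] at hδ
  have ha : 0 < Real.sqrt (α ^ 2 - 1) := Real.sqrt_pos.2 (by linarith)
  have hb : 0 < Real.sqrt (β ^ 2 - 1) := Real.sqrt_pos.2 (by linarith)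
  have ha2 : Real.sqrt (α ^ 2 - 1) ^ 2 = α ^ 2 - 1 := Real.sq_sqrt (by linarith)
  have hb2 : Real.sqrt (β ^ 2 - 1) ^ 2 = β ^ 2 - 1 := Real.sq_sqrt (by linarith)
  generalize Real.sqrt (α ^ 2 - 1) = a at *
  generalize Real.sqrt (β ^ 2 - 1) = b at *
  have hD : α - β ≠ 0 := sub_ne_zero.2 hαβ
  have hab : 0 < a * b := mul_pos ha hb
  have hs : 0 < a + b := add_pos ha hb
  have hδD : δ * (α - β) = α * β - 1 + a * b := by
    rw [hδ]; field_simp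
  have h1 : (δ + α) * (α - β) = a * (a + b) := by linear_combination hδD - ha2
  have h2 : (δ - β) * (α - β) = b * (a + b) := by linear_combination hδD - hb2
  have hS : (a + b) ^ 2 - (α - β) ^ 2 = 2 * (α * β - 1 + a * b) := by
    linear_combination ha2 + hb2
  have hprod : (a * b) ^ 2 = (α ^ 2 - 1) * (β ^ 2 - 1) := by rw [mul_pow, ha2, hb2]
  have h3 : (δ ^ 2 - 1) * (α - β) ^ 2 = a * b * ((a + b) ^ 2 - (α - β) ^ 2) := by
    rw [hS]
    linear_combination (δ * (α - β) + (α * β - 1 + a * b)) * hδD - hprod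
  have hsign : (0 < α * β ∧ 0 < α * β - 1 + a * b) ∨ (α * β < 0 ∧ α * β - 1 + a * b < 0) := by
    rcases lt_abs.1 hab1 with h | h
    · left; constructor <;> linarith
    · right
      have : a * b < -(α * β) := by
        apply lt_of_pow_lt_pow_left₀ 2 (by linarith)
        rw [hprod]; nlinarith
      constructor <;> linarith
  have hN : α * β - 1 + a * b ≠ 0 := by
    rcases hsign with h | h
    · exact h.2.ne'
    · exact h.2.ne
  have hsq : δ ^ 2 - 1 ≠ 0 := by
    intro h
    rw [h, hS, zero_mul] at h3
    exact (mul_ne_zero hab.ne' (mul_ne_zero two_ne_zero hN)) h3.symm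
  have hda : δ + α ≠ 0 := by
    intro h
    rw [h, zero_mul] at h1
    exact (mul_pos ha hs).ne h1
  have hdb : δ - β ≠ 0 := by
    intro h
    rw [h, zero_mul] at h2
    exact (mul_pos hb hs).ne h2
  have h12 : (δ + α) * (δ - β) * (α - β) ^ 2 = a * b * (a + b) ^ 2 := by
    linear_combination (δ - β) * (α - β) * h1 + a * (a + b) * h2
  have key : ∀ γ : ℝ, γ * (δ ^ 2 - 1) / ((δ + α) * (δ - β))
      = γ * ((a + b) ^ 2 - (α - β) ^ 2) / (a + b) ^ 2 := by
    intro γ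
    rw [div_eq_div_iff (mul_ne_zero hda hdb) (pow_ne_zero 2 hs.ne')]
    apply mul_right_cancel₀ (mul_ne_zero hab.ne' (pow_ne_zero 2 hD))
    linear_combination γ * (a + b) ^ 2 * (a * b) * h3
      - γ * ((a + b) ^ 2 - (α - β) ^ 2) * (a * b) * h12
  refine ⟨?_, ?_, ?_, ?_, key, ?_⟩
  · rintro rfl; exact hsq (by norm_num)
  · rintro rfl; exact hsq (by norm_num)
  · rintro rfl; exact hda (by ring)
  · rintro rfl; exact hdb (by ring)
  · intro γ
    rw [key, hS, div_le_iff₀ (by positivity), zero_mul]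
    rcases hsign with ⟨h, h'⟩ | ⟨h, h'⟩
    · exact sign_pos_aux _ _ γ (by linarith) h
    · exact sign_neg_aux _ _ γ (by linarith) h
end

section
/- Let α≠1 be a real number, let w:[0,1]→ℝ be continuously differentiable with w(0)=α·w(1), and let f:[0,1]→ℝ be continuous. Then for every ε₁>0: ∫₀¹ w(x)f(x) dx ≤ ε₁·(1/(2(1−α)²) + 1/2)·∫₀¹ w'(x)² dx + (1/ε₁)·∫₀¹ f(x)² dx. -/
lemma cs_aux (g : ℝ → ℝ) (hg : Continuous g) (a : ℝ) (h0 : 0 ≤ a) (h1 : a ≤ 1) :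
    (∫ x in a..1, g x) ^ 2 ≤ ∫ x in (0 : ℝ)..1, (g x) ^ 2 := by
  have hint : ∀ (h : ℝ → ℝ) (_ : Continuous h) (p q : ℝ),
      IntervalIntegrable h MeasureTheory.volume p q :=
    fun h hh p q => hh.intervalIntegrable p q
  have hsplit : (∫ x in (0 : ℝ)..a, (g x) ^ 2) + (∫ x in a..1, (g x) ^ 2)
      = ∫ x in (0 : ℝ)..1, (g x) ^ 2 :=
    intervalIntegral.integral_add_adjacent_intervals
      (hint _ (by fun_prop) _ _) (hint _ (by fun_prop) _ _)
  have hpos : 0 ≤ ∫ x in (0 : ℝ)..a, (g x) ^ 2 :=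
    intervalIntegral.integral_nonneg h0 (fun x _ => sq_nonneg _)
  set I := ∫ x in a..1, g x with hI
  have hsq : 0 ≤ ∫ x in a..1, (g x - I) ^ 2 :=
    intervalIntegral.integral_nonneg h1 (fun x _ => sq_nonneg _)
  have hexp : (∫ x in a..1, (g x - I) ^ 2)
      = (∫ x in a..1, (g x) ^ 2) - (2 * I) * I + (1 - a) * I ^ 2 := by
    have e : ∀ x, (g x - I) ^ 2 = ((g x) ^ 2 - (2 * I) * g x) + I ^ 2 := fun x => by ring
    simp_rw [e]
    rw [intervalIntegral.integral_add (hint _ (by fun_prop) _ _) (hint _ (by fun_prop) _ _),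
      intervalIntegral.integral_sub (hint _ (by fun_prop) _ _) (hint _ (by fun_prop) _ _),
      intervalIntegral.integral_const_mul, intervalIntegral.integral_const, smul_eq_mul, ← hI]
  nlinarith [mul_nonneg h0 (sq_nonneg I)]

/-- If `α ≠ 1`, `w : [0,1] → ℝ` is continuously differentiable with
`w(0) = α·w(1)`, and `f` is continuous, then for every `ε₁ > 0`:
`∫₀¹ w f dx ≤ ε₁(1/(2(1−α)²) + 1/2)∫₀¹ w'² dx + (1/ε₁)∫₀¹ f² dx`. -/
theorem epsilon_estimate (α : ℝ) (hα : α ≠ 1) (w f : ℝ → ℝ)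
    (hw : ContDiff ℝ 1 w) (hf : Continuous f) (hbc : w 0 = α * w 1) :
    ∀ ε₁ : ℝ, 0 < ε₁ →
      (∫ x in (0 : ℝ)..1, w x * f x)
        ≤ ε₁ * (1 / (2 * (1 - α) ^ 2) + 1 / 2) * (∫ x in (0 : ℝ)..1, (deriv w x) ^ 2)
          + (1 / ε₁) * ∫ x in (0 : ℝ)..1, (f x) ^ 2 := by
  intro ε hε
  have hdc : Continuous (deriv w) := hw.continuous_deriv le_rfl
  have hwc : Continuous w := hw.continuous
  have hftc : ∀ a, (∫ x in a..1, deriv w x) = w 1 - w a := fun a =>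
    intervalIntegral.integral_deriv_eq_sub
      (fun x _ => (hw.differentiable one_ne_zero) x) (hdc.intervalIntegrable _ _)
  have key : ∀ a, 0 ≤ a → a ≤ 1 →
      (w 1 - w a) ^ 2 ≤ ∫ x in (0 : ℝ)..1, (deriv w x) ^ 2 := by
    intro a h0 h1
    rw [← hftc a]
    exact cs_aux _ hdc a h0 h1
  set D := ∫ x in (0 : ℝ)..1, (deriv w x) ^ 2
  have hα' : 0 < (1 - α) ^ 2 := by
    have : 1 - α ≠ 0 := sub_ne_zero.mpr (Ne.symm hα)
    positivity
  have htr : (w 1) ^ 2 ≤ D / (1 - α) ^ 2 := by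
    rw [le_div_iff₀ hα']
    have := key 0 le_rfl zero_le_one
    rw [hbc] at this
    nlinarith
  have hw2 : ∀ x, 0 ≤ x → x ≤ 1 → (w x) ^ 2 ≤ 2 * (D / (1 - α) ^ 2 + D) := by
    intro x h0 h1
    nlinarith [key x h0 h1, sq_nonneg (w 1 + (w 1 - w x))]
  have hpt : ∀ x ∈ Set.Icc (0 : ℝ) 1,
      w x * f x ≤ ε / 4 * (2 * (D / (1 - α) ^ 2 + D)) + (1 / ε) * (f x) ^ 2 := by
    intro x hx
    have h1 : ε / 4 * (w x) ^ 2 ≤ ε / 4 * (2 * (D / (1 - α) ^ 2 + D)) :=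
      mul_le_mul_of_nonneg_left (hw2 x hx.1 hx.2) (by positivity)
    have h2 : ε / 4 * (w x) ^ 2 + (1 / ε) * (f x) ^ 2 - w x * f x
        = (1 / ε) * (ε / 2 * w x - f x) ^ 2 := by
      field_simp
      ring
    have h3 : 0 ≤ (1 / ε) * (ε / 2 * w x - f x) ^ 2 := by positivity
    linarith
  have hmono := intervalIntegral.integral_mono_on (μ := MeasureTheory.volume) zero_le_one
    ((hwc.mul hf).intervalIntegrable 0 1)
    ((by fun_prop : Continuous fun x =>
      ε / 4 * (2 * (D / (1 - α) ^ 2 + D)) + (1 / ε) * (f x) ^ 2).intervalIntegrable 0 1) hpt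
  rw [intervalIntegral.integral_add (Continuous.intervalIntegrable (by fun_prop) _ _)
    (Continuous.intervalIntegrable (by fun_prop) _ _), intervalIntegral.integral_const,
    intervalIntegral.integral_const_mul, smul_eq_mul] at hmono
  refine hmono.trans (le_of_eq ?_)
  congr 1
  field_simp
  ring
end

section
/- Let 0<ν<1, σ=1−ν/2, τ>0, n≥0, and let y⁰,y¹,…,y^{n+1} be arbitrary real numbers. Then (σ·y^{n+1}+(1−σ)·y^n)·Δ₀ₜ_{n+σ}^ν y ≥ (1/2)·Δ₀ₜ_{n+σ}^ν (y²), where Δ₀ₜ_{n+σ}^ν applied to (y²) means (τ^{−ν}/Γ(2−ν)) Σ_{s=0}^n c_{n−s}^{(ν,σ)}((y^{s+1})²−(y^s)²). -/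
open scoped BigOperators

/-- Tangent line bound for `x ^ p`, `0 ≤ p ≤ 1`. -/
theorem aux_tangent_concave {p x z : ℝ} (hp0 : 0 ≤ p) (hp1 : p ≤ 1) (hx : 0 < x) (hz : 0 < z) :
    x ^ p ≤ z ^ p + p * z ^ (p - 1) * (x - z) := by
  have h1 : -1 ≤ (x - z) / z := by
    rw [le_div_iff₀ hz]; linarith
  have h := rpow_one_add_le_one_add_mul_self h1 hp0 hp1
  have e : 1 + (x - z) / z = x / z := by field_simp; ring
  rw [e, Real.div_rpow hx.le hz.le, div_le_iff₀ (Real.rpow_pos_of_pos hz p)] at h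
  rw [Real.rpow_sub hz, Real.rpow_one]
  calc x ^ p ≤ _ := h
    _ = _ := by field_simp

theorem aux_tangent_convex {p x z : ℝ} (hp1 : 1 ≤ p) (hx : 0 < x) (hz : 0 < z) :
    z ^ p + p * z ^ (p - 1) * (x - z) ≤ x ^ p := by
  have h1 : -1 ≤ (x - z) / z := by
    rw [le_div_iff₀ hz]; linarith
  have h := one_add_mul_self_le_rpow_one_add h1 hp1
  have e : 1 + (x - z) / z = x / z := by field_simp; ring
  rw [e, Real.div_rpow hx.le hz.le, le_div_iff₀ (Real.rpow_pos_of_pos hz p)] at h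
  rw [Real.rpow_sub hz, Real.rpow_one]
  calc _ = _ := by field_simp
    _ ≤ x ^ p := h

theorem aux_midpoint_concave {p x : ℝ} (hp0 : 0 ≤ p) (hp1 : p ≤ 1) (hx : 0 < x) :
    x ^ p + (x + 2) ^ p ≤ 2 * (x + 1) ^ p := by
  have h1 := aux_tangent_concave hp0 hp1 hx (by linarith : 0 < x + 1)
  have h2 := aux_tangent_concave hp0 hp1 (by linarith : 0 < x + 2) (by linarith : 0 < x + 1)
  linarith

theorem aux_midpoint_convex {p x : ℝ} (hp : 0 ≤ p) (hx : 0 < x) :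
    2 * (x + 1) ^ (-p) ≤ x ^ (-p) + (x + 2) ^ (-p) := by
  have hu := Real.rpow_pos_of_pos hx (-p)
  have hw := Real.rpow_pos_of_pos (by linarith : 0 < x + 2) (-p)
  have ht := Real.rpow_pos_of_pos (by linarith : 0 < x + 1) (-p)
  have h : (x + 1) ^ (-p) * (x + 1) ^ (-p) ≤ x ^ (-p) * (x + 2) ^ (-p) := by
    rw [← Real.mul_rpow (by linarith) (by linarith), ← Real.mul_rpow (by linarith) (by linarith)]
    apply Real.rpow_le_rpow_of_nonpos (by positivity) (by nlinarith) (by linarith)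
  nlinarith [sq_nonneg (x ^ (-p) - (x + 2) ^ (-p))]

/-- `G(x) = x^(2-ν)/(2-ν) - x^(1-ν)/2`. -/
noncomputable def auxG (ν x : ℝ) : ℝ := x ^ (2 - ν) / (2 - ν) - x ^ (1 - ν) / 2

theorem auxG_hasDerivAt {ν x : ℝ} (hν1 : ν < 1) (hx : 0 < x) :
    HasDerivAt (auxG ν) (x ^ (1 - ν) - (1 - ν) * x ^ (-ν) / 2) x := by
  have h1 := (Real.hasDerivAt_rpow_const (x := x) (p := 2 - ν) (Or.inl hx.ne')).div_const (2 - ν)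
  have h2 := (Real.hasDerivAt_rpow_const (x := x) (p := 1 - ν) (Or.inl hx.ne')).div_const 2
  have h := h1.sub h2
  have e1 : 2 - ν - 1 = 1 - ν := by ring
  have e2 : 1 - ν - 1 = -ν := by ring
  rw [e1, e2, mul_div_cancel_left₀ _ (by linarith : 2 - ν ≠ 0)] at h
  exact h

theorem auxG_third {ν x : ℝ} (hν0 : 0 < ν) (hν1 : ν < 1) (hx : 0 < x) :
    auxG ν (x + 3) - 2 * auxG ν (x + 2) + auxG ν (x + 1)
      ≤ auxG ν (x + 2) - 2 * auxG ν (x + 1) + auxG ν x := by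
  let D : ℝ → ℝ := fun t => auxG ν (t + 2) - 2 * auxG ν (t + 1) + auxG ν t
  have hD : ∀ t, 0 < t → HasDerivAt D
      (((t + 2) ^ (1 - ν) - (1 - ν) * (t + 2) ^ (-ν) / 2)
        - 2 * ((t + 1) ^ (1 - ν) - (1 - ν) * (t + 1) ^ (-ν) / 2)
        + (t ^ (1 - ν) - (1 - ν) * t ^ (-ν) / 2)) t := by
    intro t ht
    have h0 := auxG_hasDerivAt hν1 ht
    have h1 := (auxG_hasDerivAt hν1 (by linarith : 0 < t + 1)).comp_add_const t 1
    have h2 := (auxG_hasDerivAt hν1 (by linarith : 0 < t + 2)).comp_add_const t 2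
    exact (h2.sub (h1.const_mul 2)).add h0
  have hanti : AntitoneOn D (Set.Ioi 0) := by
    apply antitoneOn_of_deriv_nonpos (convex_Ioi 0)
    · intro t ht
      exact (hD t ht).continuousAt.continuousWithinAt
    · intro t ht
      rw [interior_Ioi] at ht
      exact (hD t ht).differentiableAt.differentiableWithinAt
    · intro t ht
      rw [interior_Ioi] at ht
      rw [(hD t ht).deriv]
      have h1 := aux_midpoint_concave (p := 1 - ν) (by linarith) (by linarith) ht
      have h2 := aux_midpoint_convex hν0.le ht
      nlinarith
  have h := hanti (Set.mem_Ioi.2 hx) (Set.mem_Ioi.2 (by linarith : 0 < x + 1)) (by linarith)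
  simp only [D] at h
  have e1 : x + 1 + 2 = x + 3 := by ring
  have e2 : x + 1 + 1 = x + 2 := by ring
  rw [e1, e2] at h
  exact h

/-- Trapezoid rule underestimates for the concave `x^(1-ν)`. -/
theorem aux_trapezoid {ν x : ℝ} (hν0 : 0 < ν) (hν1 : ν < 1) (hx : 0 < x) :
    0 ≤ ((x + 1) ^ (2 - ν) - x ^ (2 - ν)) / (2 - ν) - ((x + 1) ^ (1 - ν) + x ^ (1 - ν)) / 2 := by
  let D : ℝ → ℝ := fun t => (t ^ (2 - ν) - x ^ (2 - ν)) / (2 - ν)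
    - (t - x) * (t ^ (1 - ν) + x ^ (1 - ν)) / 2
  have hD : ∀ t, 0 < t → HasDerivAt D
      (t ^ (1 - ν) - ((t ^ (1 - ν) + x ^ (1 - ν)) + (t - x) * ((1 - ν) * t ^ (1 - ν - 1))) / 2) t := by
    intro t ht
    have h1 := ((Real.hasDerivAt_rpow_const (x := t) (p := 2 - ν)
      (Or.inl ht.ne')).sub_const (x ^ (2 - ν))).div_const (2 - ν)
    have h2 := (Real.hasDerivAt_rpow_const (x := t) (p := 1 - ν)
      (Or.inl ht.ne')).add_const (x ^ (1 - ν))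
    have h3 := ((((hasDerivAt_id t).sub_const x).mul h2).div_const 2)
    have h := h1.sub h3
    have e1 : 2 - ν - 1 = 1 - ν := by ring
    rw [e1, mul_div_cancel_left₀ _ (by linarith : 2 - ν ≠ 0), one_mul] at h
    exact h
  have hmono : MonotoneOn D (Set.Ici x) := by
    apply monotoneOn_of_deriv_nonneg (convex_Ici x)
    · intro t ht
      exact (hD t (lt_of_lt_of_le hx ht)).continuousAt.continuousWithinAt
    · intro t ht
      rw [interior_Ici] at ht
      exact (hD t (lt_trans hx ht)).differentiableAt.differentiableWithinAt
    · intro t ht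
      rw [interior_Ici] at ht
      rw [(hD t (lt_trans hx ht)).deriv]
      have h1 := aux_tangent_concave (p := 1 - ν) (by linarith) (by linarith) hx (lt_trans hx ht)
      linarith
  have h := hmono (Set.mem_Ici.2 le_rfl) (Set.mem_Ici.2 (by linarith : x ≤ x + 1)) (by linarith)
  simp only [D] at h
  simpa using h

theorem aux_bcoef_nonneg {ν : ℝ} (hν0 : 0 < ν) (hν1 : ν < 1) (l : ℕ) :
    0 ≤ bcoef ν (1 - ν / 2) (l + 1) := by
  have hl : (0 : ℝ) ≤ l := Nat.cast_nonneg l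
  have h := aux_trapezoid hν0 hν1 (by linarith : 0 < (l : ℝ) + (1 - ν / 2))
  unfold bcoef
  push_cast
  convert h using 1
  ring_nf

/-- interior coefficients -/
theorem aux_interior {ν : ℝ} (hν1 : ν < 1) (s : ℕ) :
    acoef ν (1 - ν / 2) (s + 1) + bcoef ν (1 - ν / 2) (s + 1 + 1) - bcoef ν (1 - ν / 2) (s + 1)
      = auxG ν ((s : ℝ) + (1 - ν / 2) + 2) - 2 * auxG ν ((s : ℝ) + (1 - ν / 2) + 1)
        + auxG ν ((s : ℝ) + (1 - ν / 2)) := by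
  unfold acoef bcoef auxG
  push_cast
  rw [show (s : ℝ) + 1 + 1 + (1 - ν / 2) = s + (1 - ν / 2) + 2 by ring,
    show (s : ℝ) + 1 + 1 - 1 + (1 - ν / 2) = s + (1 - ν / 2) + 1 by ring,
    show (s : ℝ) + 1 + (1 - ν / 2) = s + (1 - ν / 2) + 1 by ring,
    show (s : ℝ) + 1 - 1 + (1 - ν / 2) = s + (1 - ν / 2) by ring]
  ring

theorem auxG_eq {ν x : ℝ} (hν1 : ν < 1) (hx : 0 < x) :
    (2 - ν) * auxG ν x = x ^ (1 - ν) * (x - (1 - ν / 2)) := by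
  have h2 : 2 - ν ≠ 0 := by linarith
  unfold auxG
  rw [show (2 - ν) = (1 - ν) + 1 by ring, Real.rpow_add_one hx.ne']
  have h3 : 1 - ν + 1 ≠ 0 := by linarith
  field_simp
  ring

theorem aux_c0 {ν : ℝ} (hν1 : ν < 1) :
    acoef ν (1 - ν / 2) 0 + bcoef ν (1 - ν / 2) 1 = auxG ν (1 + (1 - ν / 2)) := by
  have h0 : 0 < 1 - ν / 2 := by linarith
  have h := auxG_eq hν1 h0
  rw [sub_self, mul_zero] at h
  have h2 : auxG ν (1 - ν / 2) = 0 := by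
    rcases mul_eq_zero.1 h with h | h
    · linarith
    · exact h
  unfold auxG at h2 ⊢
  unfold acoef bcoef
  push_cast
  rw [show (1 : ℝ) - 1 + (1 - ν / 2) = 1 - ν / 2 by ring]
  linarith [sub_div ((1 + (1 - ν / 2)) ^ (2 - ν)) ((1 - ν / 2) ^ (2 - ν)) (2 - ν)]

theorem aux_last_nonneg {ν : ℝ} (hν0 : 0 < ν) (hν1 : ν < 1) (l : ℕ) :
    0 ≤ acoef ν (1 - ν / 2) (l + 1) - bcoef ν (1 - ν / 2) (l + 1) := by
  have hl : (0 : ℝ) ≤ l := Nat.cast_nonneg l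
  have hx : 0 < (l : ℝ) + (1 - ν / 2) := by linarith
  unfold acoef bcoef
  push_cast
  rw [show (l : ℝ) + 1 + (1 - ν / 2) = l + (1 - ν / 2) + 1 by ring,
    show (l : ℝ) + 1 - 1 + (1 - ν / 2) = l + (1 - ν / 2) by ring]
  generalize (l : ℝ) + (1 - ν / 2) = x at hx
  have h1 := aux_tangent_convex (p := 2 - ν) (by linarith) hx (by linarith : 0 < x + 1)
  rw [show 2 - ν - 1 = 1 - ν by ring] at h1
  have h2 : ((x + 1) ^ (2 - ν) - x ^ (2 - ν)) / (2 - ν) ≤ (x + 1) ^ (1 - ν) := by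
    rw [div_le_iff₀ (by linarith)]
    linarith
  have h3 : x ^ (1 - ν) ≤ (x + 1) ^ (1 - ν) :=
    Real.rpow_le_rpow hx.le (by linarith) (by linarith)
  linarith

theorem aux_c0_pos {ν : ℝ} (hν1 : ν < 1) : 0 < auxG ν (1 + (1 - ν / 2)) := by
  have hx : 0 < 1 + (1 - ν / 2) := by linarith
  have h := auxG_eq hν1 hx
  have h2 := Real.rpow_pos_of_pos hx (1 - ν)
  rw [show 1 + (1 - ν / 2) - (1 - ν / 2) = 1 by ring, mul_one] at h
  by_contra hc
  nlinarith

/-- key: `(2σ-1) c₀ ≥ σ c₁`. -/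
theorem aux_key {ν : ℝ} (hν0 : 0 < ν) (hν1 : ν < 1) :
    (1 - ν / 2) * (acoef ν (1 - ν / 2) 1 + bcoef ν (1 - ν / 2) 2 - bcoef ν (1 - ν / 2) 1)
      ≤ (1 - ν) * (acoef ν (1 - ν / 2) 0 + bcoef ν (1 - ν / 2) 1) := by
  have hi := aux_interior hν1 0
  norm_num at hi
  rw [hi, aux_c0 hν1]
  have h0 := auxG_eq hν1 (by linarith : 0 < 1 - ν / 2)
  have hx : 0 < 1 - ν / 2 + 1 := by linarith
  have h1 := auxG_eq hν1 hx
  have h2 := auxG_eq hν1 (by linarith : 0 < 1 - ν / 2 + 2)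
  rw [show 1 + (1 - ν / 2) = 1 - ν / 2 + 1 by ring]
  rw [show 1 - ν / 2 + 1 - (1 - ν / 2) = 1 by ring] at h1
  rw [show 1 - ν / 2 + 2 - (1 - ν / 2) = 2 by ring] at h2
  rw [sub_self] at h0
  have ht := aux_tangent_concave (p := 1 - ν) (by linarith) (by linarith)
    (by linarith : 0 < 1 - ν / 2 + 2) hx
  rw [Real.rpow_sub_one hx.ne'] at ht
  have hA := Real.rpow_pos_of_pos hx (1 - ν)
  generalize (1 - ν / 2 + 1) ^ (1 - ν) = A at *
  generalize (1 - ν / 2 + 2) ^ (1 - ν) = B at *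
  generalize auxG ν (1 - ν / 2) = g0 at *
  generalize auxG ν (1 - ν / 2 + 1) = g1 at *
  generalize auxG ν (1 - ν / 2 + 2) = g2 at *
  have hB : (1 - ν / 2 + 1) * B ≤ (1 - ν / 2 + 1) * A + (1 - ν) * A := by
    calc (1 - ν / 2 + 1) * B ≤ (1 - ν / 2 + 1) * _ := mul_le_mul_of_nonneg_left ht hx.le
      _ = (1 - ν / 2 + 1) * A + (1 - ν) * (A / (1 - ν / 2 + 1) * (1 - ν / 2 + 1)) := by ring
      _ = _ := by rw [div_mul_cancel₀ _ hx.ne']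
  have hg0 : g0 = 0 := by
    rcases mul_eq_zero.1 (h0.trans (mul_zero _)) with h | h
    · linarith
    · exact h
  subst hg0
  -- reduce to `(2-ν) B ≤ (3-2ν) A`
  have hfin : (2 - ν) * B ≤ (3 - 2 * ν) * A := by
    have : (1 - ν / 2 + 1) * ((2 - ν) * B) ≤ (1 - ν / 2 + 1) * ((3 - 2 * ν) * A) := by
      nlinarith [mul_pos hν0 hA, mul_nonneg (mul_nonneg hν0.le (by linarith : 0 ≤ 1 - ν)) hA.le]
    exact le_of_mul_le_mul_left this hx
  have h2ν : 0 < 2 - ν := by linarith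
  refine le_of_mul_le_mul_left ?_ h2ν
  have e1 : (2 - ν) * ((1 - ν / 2) * (g2 - 2 * g1 + 0)) = (1 - ν / 2) * (B * 2 - 2 * A) := by
    rw [← h2]; linear_combination (-2 * (1 - ν / 2)) * h1
  have e2 : (2 - ν) * ((1 - ν) * g1) = (1 - ν) * A := by
    linear_combination (1 - ν) * h1
  rw [e1, e2]
  linarith

theorem aux_abel (g w : ℕ → ℝ) (m : ℕ) (h0 : 0 ≤ g 0) (hg : ∀ s, s < m → g s ≤ g (s + 1)) :
    -(g m * w (m + 1) ^ 2) ≤ ∑ s ∈ Finset.range (m + 1), g s * (w s ^ 2 - w (s + 1) ^ 2) := by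
  induction m with
  | zero => 
    simp
    nlinarith [mul_nonneg h0 (sq_nonneg (w 0))]
  | succ m ih =>
    have := ih (fun s hs => hg s (by omega))
    rw [Finset.sum_range_succ]
    have h := mul_le_mul_of_nonneg_right (hg m (by omega)) (sq_nonneg (w (m + 1)))
    nlinarith

theorem aux_mono {ν : ℝ} (hν0 : 0 < ν) (hν1 : ν < 1) (n s : ℕ) (hs : 1 ≤ s) (hsn : s < n) :
    ccoef ν (1 - ν / 2) n (s + 1) ≤ ccoef ν (1 - ν / 2) n s := by
  obtain ⟨k, rfl⟩ : ∃ k, s = k + 1 := ⟨s - 1, by omega⟩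
  have h1 : ccoef ν (1 - ν / 2) n (k + 1 + 1) ≤ acoef ν (1 - ν / 2) (k + 1 + 1)
      + bcoef ν (1 - ν / 2) (k + 1 + 1 + 1) - bcoef ν (1 - ν / 2) (k + 1 + 1) := by
    unfold ccoef
    rw [if_neg (by omega), if_neg (by omega)]
    split_ifs with h
    · subst h
      linarith [aux_bcoef_nonneg hν0 hν1 (k + 1 + 1)]
    · exact le_rfl
  refine h1.trans ?_
  unfold ccoef
  rw [if_neg (by omega), if_neg (by omega), if_neg (by omega), aux_interior hν1, aux_interior hν1]
  have hk : (0 : ℝ) ≤ k := Nat.cast_nonneg k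
  have h := auxG_third hν0 hν1 (by linarith : 0 < (k : ℝ) + (1 - ν / 2))
  push_cast
  rw [show (k : ℝ) + 1 + (1 - ν / 2) + 2 = k + (1 - ν / 2) + 3 by ring,
    show (k : ℝ) + 1 + (1 - ν / 2) + 1 = k + (1 - ν / 2) + 2 by ring,
    show (k : ℝ) + 1 + (1 - ν / 2) = k + (1 - ν / 2) + 1 by ring]
  exact h

theorem aux_key_c {ν : ℝ} (hν0 : 0 < ν) (hν1 : ν < 1) (n : ℕ) :
    (1 - ν / 2) * ccoef ν (1 - ν / 2) (n + 1) 1 ≤ (1 - ν) * ccoef ν (1 - ν / 2) (n + 1) 0 := by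
  have h1 : ccoef ν (1 - ν / 2) (n + 1) 1 ≤ acoef ν (1 - ν / 2) 1
      + bcoef ν (1 - ν / 2) 2 - bcoef ν (1 - ν / 2) 1 := by
    unfold ccoef
    rw [if_neg (by omega), if_neg (by omega)]
    split_ifs with h
    · rw [← h]
      linarith [aux_bcoef_nonneg hν0 hν1 1]
    · exact le_rfl
  have h2 : ccoef ν (1 - ν / 2) (n + 1) 0 = acoef ν (1 - ν / 2) 0 + bcoef ν (1 - ν / 2) 1 := by
    simp [ccoef]
  rw [h2]
  exact (mul_le_mul_of_nonneg_left h1 (by linarith)).trans (aux_key hν0 hν1)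

theorem aux_sum {ν : ℝ} (hν0 : 0 < ν) (hν1 : ν < 1) (n : ℕ) (w : ℕ → ℝ)
    (d : ℝ) (hn : w n = (1 - ν / 2) * d) (hn1 : w (n + 1) = -(ν / 2) * d) :
    0 ≤ ∑ s ∈ Finset.range (n + 1),
      ccoef ν (1 - ν / 2) n (n - s) * (w s ^ 2 - w (s + 1) ^ 2) := by
  rcases n with _ | m
  · have hc : 0 < (1 - ν / 2) ^ (1 - ν) := Real.rpow_pos_of_pos (by linarith) _
    simp only [zero_add] at hn1
    simp only [zero_add, Finset.sum_range_one, hn, hn1, ccoef, acoef, if_true]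
    apply mul_nonneg hc.le
    nlinarith [mul_nonneg (by linarith : 0 ≤ 1 - ν) (sq_nonneg d)]
  · have hc0 : 0 < ccoef ν (1 - ν / 2) (m + 1) 0 := by
      have h2 : ccoef ν (1 - ν / 2) (m + 1) 0
          = acoef ν (1 - ν / 2) 0 + bcoef ν (1 - ν / 2) 1 := by
        simp [ccoef]
      rw [h2, aux_c0 hν1]
      exact aux_c0_pos hν1
    have hk := aux_key_c hν0 hν1 m
    have ha := aux_abel (fun s => ccoef ν (1 - ν / 2) (m + 1) (m + 1 - s)) w m
      (by
        have := aux_last_nonneg hν0 hν1 m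
        simpa [ccoef] using this)
      (by
        intro s hs
        have h := aux_mono hν0 hν1 (m + 1) (m - s) (by omega) (by omega)
        have e1 : m + 1 - s = m - s + 1 := by omega
        have e2 : m + 1 - (s + 1) = m - s := by omega
        simpa only [e1, e2] using h)
    rw [Finset.sum_range_succ]
    simp only [Nat.add_sub_cancel_left, Nat.sub_self] at ha ⊢
    rw [hn] at ha
    rw [hn, hn1]
    generalize ccoef ν (1 - ν / 2) (m + 1) 0 = c0 at *
    generalize ccoef ν (1 - ν / 2) (m + 1) 1 = c1 at *
    have hd := sq_nonneg d
    have h1 : (1 - ν / 2) * ((1 - ν / 2) * c1) * d ^ 2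
        ≤ (1 - ν / 2) * ((1 - ν) * c0) * d ^ 2 :=
      mul_le_mul_of_nonneg_right (mul_le_mul_of_nonneg_left hk (by linarith)) hd
    have h2 : 0 ≤ (ν / 2 * (1 - ν)) * (c0 * d ^ 2) :=
      mul_nonneg (mul_nonneg (by linarith) (by linarith)) (mul_nonneg hc0.le hd)
    nlinarith

/-- For `0 < ν < 1`, `σ = 1 − ν/2`, `τ > 0`, `n ≥ 0` and arbitrary real
numbers `y⁰, …, y^{n+1}`:
`(σ·y^{n+1} + (1−σ)·y^n)·Δ₀ₜ_{n+σ}^ν y ≥ (1/2)·Δ₀ₜ_{n+σ}^ν (y²)`. -/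
theorem discrete_energy_inequality (ν τ : ℝ) (hν0 : 0 < ν) (hν1 : ν < 1)
    (hτ : 0 < τ) (n : ℕ) (y : ℕ → ℝ) :
    ((1 - ν / 2) * y (n + 1) + (1 - (1 - ν / 2)) * y n)
        * discFracDeriv ν (1 - ν / 2) τ n y
      ≥ (1 / 2) * discFracDeriv ν (1 - ν / 2) τ n (fun s => (y s) ^ 2) := by
  have hK : 0 ≤ τ ^ (-ν) / Real.Gamma (2 - ν) :=
    div_nonneg (Real.rpow_nonneg hτ.le _) (Real.Gamma_pos_of_pos (by linarith)).le
  unfold discFracDeriv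
  generalize τ ^ (-ν) / Real.Gamma (2 - ν) = K at hK
  set v := (1 - ν / 2) * y (n + 1) + (1 - (1 - ν / 2)) * y n with hv
  have h := aux_sum hν0 hν1 n (fun s => v - y s) (y (n + 1) - y n)
    (by simp only [hv]; ring) (by simp only [hv]; ring)
  have e : ∑ s ∈ Finset.range (n + 1), ccoef ν (1 - ν / 2) n (n - s)
        * ((v - y s) ^ 2 - (v - y (s + 1)) ^ 2)
      = 2 * v * ∑ s ∈ Finset.range (n + 1), ccoef ν (1 - ν / 2) n (n - s) * (y (s + 1) - y s)
        - ∑ s ∈ Finset.range (n + 1), ccoef ν (1 - ν / 2) n (n - s)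
          * (y (s + 1) ^ 2 - y s ^ 2) := by
    rw [Finset.mul_sum, ← Finset.sum_sub_distrib]
    apply Finset.sum_congr rfl
    intro s _
    ring
  rw [e] at h
  have h2 := mul_nonneg hK h
  nlinarith
end

section
/- Let 0<ν<1 and σ=1−ν/2. For every n≥1, the coefficient c_n^{(ν,σ)} = a_n^{(ν,σ)} − b_n^{(ν,σ)} satisfies c_n^{(ν,σ)} > (1−ν)/(2(n+σ)^ν). Equivalently, with t_{n+σ}=(n+σ)τ and using Γ(2−ν)=(1−ν)Γ(1−ν), one has c_n^{(ν,σ)}/(τ^ν Γ(2−ν)) > 1/(2 t_{n+σ}^ν Γ(1−ν)) for every τ>0. -/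
theorem core_bound (ν y : ℝ) (hν0 : 0 < ν) (hν1 : ν < 1) (hy : 1 < y) :
    (y ^ (1 - ν) - (y - 1) ^ (1 - ν)) - ((y ^ (2 - ν) - (y - 1) ^ (2 - ν)) / (2 - ν)
      - (y ^ (1 - ν) + (y - 1) ^ (1 - ν)) / 2) > (1 - ν) / (2 * y ^ ν) := by
  have hy0 : 0 < y := by linarith
  have hinv : y⁻¹ < 1 := inv_lt_one_of_one_lt₀ hy
  have hinv0 : 0 < y⁻¹ := by positivity
  have hx : y - 1 = y * (1 + -y⁻¹) := by field_simp; ring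
  have hr0 : 0 ≤ 1 + -y⁻¹ := by linarith
  have h1 : (1 + -y⁻¹) ^ (1 - ν) ≤ 1 + (1 - ν) * -y⁻¹ :=
    rpow_one_add_le_one_add_mul_self (by linarith) (by linarith) (by linarith)
  have h2 : 1 + (2 - ν) * -y⁻¹ < (1 + -y⁻¹) ^ (2 - ν) :=
    one_add_mul_self_lt_rpow_one_add (by linarith) (by linarith) (by linarith)
  have hY : 0 < y ^ ν := Real.rpow_pos_of_pos hy0 ν
  have e1 : y ^ (1 - ν) = y / y ^ ν := by rw [Real.rpow_sub hy0, Real.rpow_one]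
  have e2 : y ^ (2 - ν) = y ^ 2 / y ^ ν := by
    rw [Real.rpow_sub hy0]; norm_num
  have k1 : (y - 1) ^ (1 - ν) ≤ (y - (1 - ν)) / y ^ ν := by
    rw [hx, Real.mul_rpow hy0.le hr0, e1]
    calc _ ≤ y / y ^ ν * (1 + (1 - ν) * -y⁻¹) := by gcongr
      _ = _ := by field_simp; ring
  have k2 : (y ^ 2 - (2 - ν) * y) / y ^ ν < (y - 1) ^ (2 - ν) := by
    rw [hx, Real.mul_rpow hy0.le hr0, e2]
    calc _ = y ^ 2 / y ^ ν * (1 + (2 - ν) * -y⁻¹) := by field_simp; ring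
      _ < _ := by gcongr
  have k3 : (y ^ (2 - ν) - (y - 1) ^ (2 - ν)) / (2 - ν) < y / y ^ ν := by
    rw [div_lt_iff₀ (by linarith), e2]
    have : (y ^ 2 - (2 - ν) * y) / y ^ ν = y ^ 2 / y ^ ν - y / y ^ ν * (2 - ν) := by ring
    linarith
  have e3 : (1 - ν) / (2 * y ^ ν) = (1 - ν) / y ^ ν / 2 := by ring
  have e4 : (y - (1 - ν)) / y ^ ν = y / y ^ ν - (1 - ν) / y ^ ν := by ring
  rw [e3]
  rw [e4] at k1
  rw [e1]
  linarith

/-- For `0 < ν < 1`, `σ = 1 − ν/2` and every `n ≥ 1`, the coefficient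
`c_n^{(ν,σ)} = a_n^{(ν,σ)} − b_n^{(ν,σ)}` satisfies `c_n^{(ν,σ)} > (1−ν)/(2(n+σ)^ν)`;
equivalently, with `t_{n+σ} = (n+σ)τ` and `Γ(2−ν) = (1−ν)Γ(1−ν)`, for every `τ > 0`:
`c_n^{(ν,σ)}/(τ^ν Γ(2−ν)) > 1/(2 t_{n+σ}^ν Γ(1−ν))`. -/
theorem ccoef_lower_bound (ν : ℝ) (hν0 : 0 < ν) (hν1 : ν < 1) (n : ℕ) (hn : 1 ≤ n) :
    acoef ν (1 - ν / 2) n - bcoef ν (1 - ν / 2) n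
        > (1 - ν) / (2 * ((n : ℝ) + (1 - ν / 2)) ^ ν) ∧
    ∀ τ : ℝ, 0 < τ →
      (acoef ν (1 - ν / 2) n - bcoef ν (1 - ν / 2) n) / (τ ^ ν * Real.Gamma (2 - ν))
        > 1 / (2 * (((n : ℝ) + (1 - ν / 2)) * τ) ^ ν * Real.Gamma (1 - ν)) := by
  have main : acoef ν (1 - ν / 2) n - bcoef ν (1 - ν / 2) n
        > (1 - ν) / (2 * ((n : ℝ) + (1 - ν / 2)) ^ ν) := by
    obtain ⟨m, rfl⟩ : ∃ m, n = m + 1 := ⟨n - 1, by omega⟩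
    have hm : (0 : ℝ) ≤ m := m.cast_nonneg
    have h := core_bound ν ((m : ℝ) + 1 + (1 - ν / 2)) hν0 hν1 (by linarith)
    have e : (m : ℝ) + 1 + (1 - ν / 2) - 1 = m + (1 - ν / 2) := by ring
    have e' : (m : ℝ) + 1 - 1 + (1 - ν / 2) = m + (1 - ν / 2) := by ring
    rw [e] at h
    simp only [acoef, bcoef, Nat.cast_add, Nat.cast_one, e']
    exact h
  refine ⟨main, fun τ hτ => ?_⟩
  have hn0 : (0 : ℝ) ≤ n := n.cast_nonneg
  have hy : 0 < (n : ℝ) + (1 - ν / 2) := by linarith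
  have hG : 0 < Real.Gamma (1 - ν) := Real.Gamma_pos_of_pos (by linarith)
  have hG2 : Real.Gamma (2 - ν) = (1 - ν) * Real.Gamma (1 - ν) := by
    rw [← Real.Gamma_add_one (by linarith)]; congr 1; ring
  have hT : 0 < τ ^ ν := Real.rpow_pos_of_pos hτ ν
  have hY : 0 < ((n : ℝ) + (1 - ν / 2)) ^ ν := Real.rpow_pos_of_pos hy ν
  have hp : 0 < 1 - ν := by linarith
  rw [hG2, Real.mul_rpow hy.le hτ.le, gt_iff_lt, lt_div_iff₀ (by positivity)]
  refine lt_of_eq_of_lt ?_ main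
  generalize ((n : ℝ) + (1 - ν / 2)) ^ ν = Y at *
  field_simp
end

section
/- Let N≥1, h=1/N, α≠1 a real number, and y₀,y₁,…,y_N real numbers with y₀=α·y_N. Then y_N² ≤ (1/(1−α)²)·Σ_{i=1}^N ((y_i−y_{i−1})/h)²·h. -/
open scoped BigOperators

/-- Discrete trace inequality. For `N ≥ 1`, `h = 1/N`, `α ≠ 1` and grid
values `y₀, …, y_N` with `y₀ = α·y_N`:
`y_N² ≤ (1/(1−α)²)·Σ_{i=1}^N ((y_i − y_{i−1})/h)²·h`. -/
theorem discrete_trace_inequality (N : ℕ) (hN : 1 ≤ N) (α : ℝ) (hα : α ≠ 1)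
    (y : ℕ → ℝ) (hbc : y 0 = α * y N) :
    (y N) ^ 2 ≤ (1 / (1 - α) ^ 2) *
      ∑ i ∈ Finset.range N,
        ((y (i + 1) - y i) / (1 / (N : ℝ))) ^ 2 * (1 / (N : ℝ)) := by
  have hN' : (0 : ℝ) < N := by exact_mod_cast hN
  have hα' : 1 - α ≠ 0 := sub_ne_zero.mpr (Ne.symm hα)
  have hpos : 0 < (1 - α) ^ 2 := by positivity
  have hsum : ∑ i ∈ Finset.range N,
      ((y (i + 1) - y i) / (1 / (N : ℝ))) ^ 2 * (1 / (N : ℝ))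
      = (N : ℝ) * ∑ i ∈ Finset.range N, (y (i + 1) - y i) ^ 2 := by
    rw [Finset.mul_sum]
    refine Finset.sum_congr rfl fun i _ => ?_
    field_simp
  have hcs := sq_sum_le_card_mul_sum_sq (s := Finset.range N)
    (f := fun i => y (i + 1) - y i)
  rw [Finset.sum_range_sub, Finset.card_range, hbc] at hcs
  rw [hsum, one_div, inv_mul_eq_div, le_div_iff₀ hpos]
  calc y N ^ 2 * (1 - α) ^ 2 = (y N - α * y N) ^ 2 := by ring
    _ ≤ _ := hcs
end

section
/- Suppose either (1) |α|<1, |β|<1 and γ≤0, or (2) |α|>1, |β|>1 and αβγ≤0, and suppose a_i^n ≥ c₁ > 0 with a_i^n = a_{N+1−i}^n. Let z_i^n solve the error scheme: Δ₀ₜ_{n+σ}^ν z_i − (a z_x̄^{(σ)})_{x,i} = ψ_i^n for i=1,…,N−1; z₀^{n+1} − α·z_N^{n+1} = 0; β·Δ₀ₜ_{n+σ}^ν z₀ + Δ₀ₜ_{n+σ}^ν z_N + (2/h)(a_N z_{x̄,N}^{(σ)} − β·a₁ z_{x,0}^{(σ)} − γ·z_N^{(σ)}) = (2/h)ν^n +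 ψ_N^n + β·ψ₀^n; z_i⁰=0. Then there is a constant M₃>0 depending only on α, β, c₁ (independent of h, τ, T) such that |[z^{n+1}]|₀² ≤ M₃·max_{0≤n≤N_T−1}( |[ψ^{n+1}]|₀² + (ν^n)² ) for all 0≤n≤N_T−1. In particular, if the truncation errors satisfy |ψ_i^n| ≤ C(h²+τ²) and |ν^n| ≤ C(h²+τ²), then max_n |[z^{n+1}]|₀ ≤ C'·(h²+τ²), i.e., the scheme converges in the discrete L₂-norm with rate equal to its approximation order O(h²+τ²). -/
open scoped BigOperators

/-- `y^{(σ)}_i = σ y^{n+1}_i + (1−σ) y^n_i` for a grid function `y n i`. -/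
noncomputable def ysig (σ : ℝ) (y : ℕ → ℕ → ℝ) (n i : ℕ) : ℝ :=
  σ * y (n + 1) i + (1 - σ) * y n i

lemma conc_aux {p x y : ℝ} (hp0 : 0 ≤ p) (hp1 : p ≤ 1) (hx : 0 < x) (hy : 0 < y) :
    x ^ p ≤ y ^ p + p * y ^ (p - 1) * (x - y) := by
  have h := rpow_one_add_le_one_add_mul_self (s := x / y - 1)
    (by have : 0 < x / y := by positivity
        linarith) hp0 hp1
  have e1 : (1 + (x / y - 1)) = x / y := by ring
  rw [e1, Real.div_rpow hx.le hy.le] at h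
  have hyp : 0 < y ^ p := Real.rpow_pos_of_pos hy p
  rw [div_le_iff₀ hyp] at h
  rw [Real.rpow_sub_one hy.ne']
  calc x ^ p ≤ _ := h
    _ = _ := by field_simp

lemma conv_aux {q x y : ℝ} (hq0 : 0 < q) (hq1 : q < 1) (hx : 0 < x) (hxy : x ≤ y) :
    y ^ (-q) + (-q) * y ^ (-q - 1) * (x - y) ≤ x ^ (-q) := by
  have hy : 0 < y := by linarith
  have h := conc_aux hq0.le hq1.le hx hy
  have hyp : 0 < y ^ q := Real.rpow_pos_of_pos hy q
  have hxp : 0 < x ^ q := Real.rpow_pos_of_pos hx q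
  rw [Real.rpow_sub_one hy.ne'] at h ⊢
  rw [Real.rpow_neg hy.le, Real.rpow_neg hx.le]
  set u := (y - x) / y with hu
  have hu0 : 0 ≤ u := by rw [hu]; exact div_nonneg (by linarith) hy.le
  have h' : x ^ q ≤ y ^ q * (1 - q * u) := by
    calc x ^ q ≤ _ := h
      _ = _ := by rw [hu]; field_simp; ring
  have e : (y ^ q)⁻¹ + -q * ((y ^ q)⁻¹ / y) * (x - y) = (y ^ q)⁻¹ * (1 + q * u) := by
    rw [hu]; field_simp; ring
  rw [e, inv_mul_eq_div, div_le_iff₀ hyp, inv_mul_eq_div, le_div_iff₀ hxp]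
  calc (1 + q * u) * x ^ q ≤ (1 + q * u) * (y ^ q * (1 - q * u)) := by gcongr
    _ = y ^ q * (1 - (q * u) ^ 2) := by ring
    _ ≤ y ^ q * 1 := by gcongr; nlinarith [sq_nonneg (q * u)]
    _ = y ^ q := by ring

lemma trap_aux {G g k : ℝ → ℝ} {x : ℝ}
    (hG : ∀ y, x ≤ y → HasDerivAt G (g y) y) (hg : ∀ y, x ≤ y → HasDerivAt g (k y) y)
    (hk : ∀ y, x ≤ y → (y - x) * k y ≤ g y - g x) :
    (g x + g (x + 1)) / 2 ≤ G (x + 1) - G x := by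
  have hd : ∀ y, x ≤ y → HasDerivAt (fun y => G y - (y - x) * (g x + g y) / 2)
      (g y - (1 * (g x + g y) + (y - x) * k y) / 2) y := by
    intro y hy
    exact (hG y hy).sub
      ((((hasDerivAt_id' y).sub_const x).mul ((hg y hy).const_add (g x))).div_const 2)
  have hm : MonotoneOn (fun y => G y - (y - x) * (g x + g y) / 2) (Set.Ici x) := by
    apply monotoneOn_of_deriv_nonneg (convex_Ici x)
    · exact fun y hy => (hd y hy).continuousAt.continuousWithinAt
    · intro y hy
      rw [interior_Ici] at hy
      exact (hd y (le_of_lt hy)).differentiableAt.differentiableWithinAt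
    · intro y hy
      rw [interior_Ici] at hy
      rw [(hd y (le_of_lt hy)).deriv]
      have := hk y (le_of_lt hy)
      linarith
  have := hm (a := x) (b := x + 1) (by simp) (by simp) (by linarith)
  simp only at this
  linarith

noncomputable def bfun (ν x : ℝ) : ℝ :=
  ((x + 1) ^ (2 - ν) - x ^ (2 - ν)) / (2 - ν) - ((x + 1) ^ (1 - ν) + x ^ (1 - ν)) / 2

lemma hasD {p y : ℝ} (hy : 0 < y) : HasDerivAt (fun x : ℝ => x ^ p) (p * y ^ (p - 1)) y := by
  exact Real.hasDerivAt_rpow_const (Or.inl hy.ne')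

lemma hasD1 {p y : ℝ} (hy : 0 < y) :
    HasDerivAt (fun x : ℝ => (x + 1) ^ p) (p * (y + 1) ^ (p - 1)) y := by
  have := (hasD (p := p) (y := y + 1) (by linarith)).comp_add_const y 1
  exact this

lemma bfun_nonneg {ν x : ℝ} (h0 : 0 < ν) (h1 : ν < 1) (hx : 0 < x) : 0 ≤ bfun ν x := by
  have := trap_aux (G := fun x => x ^ (2 - ν) / (2 - ν)) (g := fun x => x ^ (1 - ν))
    (k := fun x => (1 - ν) * x ^ (1 - ν - 1)) (x := x)
    (fun y hy => by
      have := (hasD (p := 2 - ν) (y := y) (by linarith)).div_const (2 - ν)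
      rw [mul_div_cancel_left₀ _ (by linarith), show 2 - ν - 1 = 1 - ν by ring] at this
      exact this)
    (fun y hy => hasD (by linarith))
    (fun y hy => by
      have := conc_aux (p := 1 - ν) (x := x) (y := y) (by linarith) (by linarith) hx (by linarith)
      linarith)
  unfold bfun
  rw [sub_div]
  linarith

lemma trap2 {ν x : ℝ} (h0 : 0 < ν) (h1 : ν < 1) (hx : 0 < x) :
    (x + 1) ^ (1 - ν) - x ^ (1 - ν) ≤ (1 - ν) * ((x + 1) ^ (-ν) + x ^ (-ν)) / 2 := by
  have := trap_aux (G := fun x => - x ^ (1 - ν)) (g := fun x => -((1 - ν) * x ^ (-ν)))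
    (k := fun x => -((1 - ν) * (-ν * x ^ (-ν - 1)))) (x := x)
    (fun y hy => by
      have := (hasD (p := 1 - ν) (y := y) (by linarith)).neg
      rw [show 1 - ν - 1 = -ν by ring] at this
      exact this)
    (fun y hy => ((hasD (by linarith)).const_mul _).neg)
    (fun y hy => by
      have := conv_aux (q := ν) (x := x) (y := y) h0 h1 hx hy
      have := mul_le_mul_of_nonneg_left this (by linarith : 0 ≤ 1 - ν)
      linarith)
  linarith

lemma bfun_anti {ν : ℝ} (h0 : 0 < ν) (h1 : ν < 1) : AntitoneOn (bfun ν) (Set.Ioi 0) := by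
  have hd : ∀ y, 0 < y → HasDerivAt (bfun ν)
      (((2 - ν) * (y + 1) ^ (2 - ν - 1) - (2 - ν) * y ^ (2 - ν - 1)) / (2 - ν)
        - ((1 - ν) * (y + 1) ^ (1 - ν - 1) + (1 - ν) * y ^ (1 - ν - 1)) / 2) y := by
    intro y hy
    exact (((hasD1 hy).sub (hasD hy)).div_const _).sub (((hasD1 hy).add (hasD hy)).div_const _)
  apply antitoneOn_of_deriv_nonpos (convex_Ioi 0)
  · exact fun y hy => (hd y hy).continuousAt.continuousWithinAt
  · intro y hy
    rw [interior_Ioi] at hy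
    exact (hd y hy).differentiableAt.differentiableWithinAt
  · intro y hy
    rw [interior_Ioi] at hy
    rw [(hd y hy).deriv, ← mul_sub, mul_div_cancel_left₀ _ (by linarith : 2 - ν ≠ 0),
      show 2 - ν - 1 = 1 - ν by ring, show 1 - ν - 1 = -ν by ring]
    have := trap2 h0 h1 hy
    linarith

/-- `a - b` as a function of `x`. -/
noncomputable def dfun (ν x : ℝ) : ℝ :=
  (x + 1) ^ (1 - ν) - x ^ (1 - ν) - bfun ν x

lemma dfun_anti {ν : ℝ} (h0 : 0 < ν) (h1 : ν < 1) : AntitoneOn (dfun ν) (Set.Ioi 0) := by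
  have hd : ∀ y, 0 < y → HasDerivAt (dfun ν)
      (((1 - ν) * (y + 1) ^ (1 - ν - 1) - (1 - ν) * y ^ (1 - ν - 1)) -
      (((2 - ν) * (y + 1) ^ (2 - ν - 1) - (2 - ν) * y ^ (2 - ν - 1)) / (2 - ν)
        - ((1 - ν) * (y + 1) ^ (1 - ν - 1) + (1 - ν) * y ^ (1 - ν - 1)) / 2)) y := by
    intro y hy
    exact ((hasD1 hy).sub (hasD hy)).sub
      ((((hasD1 hy).sub (hasD hy)).div_const _).sub (((hasD1 hy).add (hasD hy)).div_const _))
  apply antitoneOn_of_deriv_nonpos (convex_Ioi 0)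
  · exact fun y hy => (hd y hy).continuousAt.continuousWithinAt
  · intro y hy
    rw [interior_Ioi] at hy
    exact (hd y hy).differentiableAt.differentiableWithinAt
  · intro y hy
    rw [interior_Ioi] at hy
    have hy' : 0 < y := hy
    rw [(hd y hy).deriv, ← mul_sub (2 - ν), mul_div_cancel_left₀ _ (by linarith : 2 - ν ≠ 0),
      show 2 - ν - 1 = 1 - ν by ring, show 1 - ν - 1 = -ν by ring]
    have a1 := conc_aux (p := 1 - ν) (x := y) (y := y + 1) (by linarith) (by linarith) hy'
      (by linarith)
    rw [show 1 - ν - 1 = -ν by ring] at a1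
    have a2 : (y + 1) ^ (-ν) ≤ y ^ (-ν) :=
      Real.rpow_le_rpow_of_nonpos hy' (by linarith) (by linarith)
    have a3 := mul_le_mul_of_nonneg_left a2 (by linarith : 0 ≤ 1 - ν)
    linarith

lemma dfun_nonneg {ν x : ℝ} (h0 : 0 < ν) (h1 : ν < 1) (hx : 0 < x) : 0 ≤ dfun ν x := by
  -- `∫ f ≤ f (x+1)` from the tangent inequality for the convex power `2 - ν`
  have a1 := one_add_mul_self_le_rpow_one_add (s := x / (x + 1) - 1)
    (by have : 0 < x / (x + 1) := by positivity
        linarith) (p := 2 - ν) (by linarith)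
  have hx1 : 0 < x + 1 := by linarith
  rw [show 1 + (x / (x + 1) - 1) = x / (x + 1) by ring, Real.div_rpow hx.le hx1.le,
    le_div_iff₀ (Real.rpow_pos_of_pos hx1 _)] at a1
  have e : (x + 1) ^ (2 - ν) = (x + 1) ^ (1 - ν) * (x + 1) := by
    rw [← Real.rpow_add_one hx1.ne']; congr 1; ring
  have a2 : (x + 1) ^ (2 - ν) - x ^ (2 - ν) ≤ (x + 1) ^ (1 - ν) * (2 - ν) := by
    have : (1 + (2 - ν) * (x / (x + 1) - 1)) * (x + 1) ^ (2 - ν)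
        = (x + 1) ^ (2 - ν) - (2 - ν) * (x + 1) ^ (1 - ν) := by
      rw [e]; field_simp; ring
    linarith
  have a3 : ((x + 1) ^ (2 - ν) - x ^ (2 - ν)) / (2 - ν) ≤ (x + 1) ^ (1 - ν) := by
    rw [div_le_iff₀ (by linarith)]; exact a2
  have a4 : x ^ (1 - ν) ≤ (x + 1) ^ (1 - ν) :=
    Real.rpow_le_rpow hx.le (by linarith) (by linarith)
  unfold dfun bfun
  linarith

lemma bcoef_succ (ν σ : ℝ) (l : ℕ) : bcoef ν σ (l + 1) = bfun ν (l + σ) := by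
  unfold bcoef bfun
  push_cast
  rw [show (l : ℝ) + 1 + σ = l + σ + 1 by ring, show (l : ℝ) + 1 - 1 + σ = l + σ by ring]

lemma acoef_succ (ν σ : ℝ) (l : ℕ) :
    acoef ν σ (l + 1) = dfun ν (l + σ) + bfun ν (l + σ) := by
  simp only [acoef, dfun]
  rw [show (l : ℝ) + 1 + σ = l + σ + 1 by ring]
  ring

lemma bfun_le {ν σ : ℝ} (h0 : 0 < ν) (h1 : ν < 1) (hσ : 0 < σ) (l : ℕ) :
    bfun ν ((l + 1 : ℕ) + σ) ≤ bfun ν (l + σ) := by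
  apply bfun_anti h0 h1
  · show (0 : ℝ) < _; positivity
  · show (0 : ℝ) < _; positivity
  · push_cast; linarith

lemma dfun_le {ν σ : ℝ} (h0 : 0 < ν) (h1 : ν < 1) (hσ : 0 < σ) (l : ℕ) :
    dfun ν ((l + 1 : ℕ) + σ) ≤ dfun ν (l + σ) := by
  apply dfun_anti h0 h1
  · show (0 : ℝ) < _; positivity
  · show (0 : ℝ) < _; positivity
  · push_cast; linarith

lemma a0_a1 {ν : ℝ} (h0 : 0 < ν) (h1 : ν < 1) :
    (1 - ν / 2) * acoef ν (1 - ν / 2) 1 ≤ (1 - ν) * acoef ν (1 - ν / 2) 0 := by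
  set σ := 1 - ν / 2 with hσd
  have hσ : 0 < σ := by rw [hσd]; linarith
  have h := conc_aux (p := 1 - ν) (x := σ + 1) (y := σ) (by linarith) (by linarith)
    (by linarith) hσ
  rw [Real.rpow_sub_one hσ.ne'] at h
  simp only [acoef, Nat.cast_zero, zero_add]
  rw [add_comm 1 σ]
  have h2 : (σ + 1) ^ (1 - ν) - σ ^ (1 - ν) ≤ (1 - ν) * (σ ^ (1 - ν) / σ) := by linarith
  calc _ ≤ σ * ((1 - ν) * (σ ^ (1 - ν) / σ)) := mul_le_mul_of_nonneg_left h2 hσ.le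
    _ = _ := by field_simp

lemma ccoef_last {ν : ℝ} (h0 : 0 < ν) (h1 : ν < 1) (n : ℕ) :
    0 ≤ ccoef ν (1 - ν / 2) n n := by
  have hσ : 0 < 1 - ν / 2 := by linarith
  unfold ccoef
  rcases n with _ | n
  · simp only [if_true, acoef]; positivity
  · simp only [Nat.succ_ne_zero, if_false, if_true, bcoef_succ, acoef_succ]
    have := dfun_nonneg h0 h1 (x := n + (1 - ν / 2)) (by positivity)
    linarith

lemma ccoef_one_le {ν : ℝ} (h0 : 0 < ν) (h1 : ν < 1) (n : ℕ) :
    ccoef ν (1 - ν / 2) (n + 1) 1 ≤ acoef ν (1 - ν / 2) 1 := by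
  have hσ : 0 < 1 - ν / 2 := by linarith
  unfold ccoef
  rcases n with _ | n
  · simp only [zero_add, one_ne_zero, if_false, if_true, bcoef_succ ν _ 0]
    have := bfun_nonneg h0 h1 (x := (0 : ℕ) + (1 - ν / 2)) (by simpa using hσ)
    have := bcoef_succ ν (1 - ν / 2) 0
    simp only [zero_add] at this
    linarith
  · rw [if_neg (by omega), if_neg (by omega), if_neg (by omega)]
    have e1 := bcoef_succ ν (1 - ν / 2) 0
    have e2 := bcoef_succ ν (1 - ν / 2) 1
    have := bfun_le h0 h1 hσ 0
    simp only [zero_add] at e1 this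
    linarith

lemma ccoef_zero_one {ν : ℝ} (h0 : 0 < ν) (h1 : ν < 1) (n : ℕ) :
    (1 - ν / 2) * ccoef ν (1 - ν / 2) (n + 1) 1 ≤ (1 - ν) * ccoef ν (1 - ν / 2) (n + 1) 0 := by
  have hσ : 0 < 1 - ν / 2 := by linarith
  have a := mul_le_mul_of_nonneg_left (ccoef_one_le h0 h1 n) hσ.le
  have b := a0_a1 h0 h1
  have c : acoef ν (1 - ν / 2) 0 ≤ ccoef ν (1 - ν / 2) (n + 1) 0 := by
    unfold ccoef
    rw [if_neg (by omega), if_pos rfl]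
    have e1 := bcoef_succ ν (1 - ν / 2) 0
    have := bfun_nonneg h0 h1 (x := (0 : ℕ) + (1 - ν / 2)) (by simpa using hσ)
    simp only [zero_add] at e1
    linarith
  have d := mul_le_mul_of_nonneg_left c (by linarith : 0 ≤ 1 - ν)
  linarith

lemma ccoef_anti {ν : ℝ} (h0 : 0 < ν) (h1 : ν < 1) (n s : ℕ) (hs : s < n) :
    ccoef ν (1 - ν / 2) n (s + 1) ≤ ccoef ν (1 - ν / 2) n s := by
  have hσ : 0 < 1 - ν / 2 := by linarith
  obtain ⟨n, rfl⟩ : ∃ m, n = m + 1 := ⟨n - 1, by omega⟩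
  rcases s with _ | s
  · have a := ccoef_zero_one h0 h1 n
    have b : 0 ≤ ccoef ν (1 - ν / 2) (n + 1) 0 := by
      unfold ccoef
      rw [if_neg (by omega), if_pos rfl]
      have e1 := bcoef_succ ν (1 - ν / 2) 0
      have := bfun_nonneg h0 h1 (x := (0 : ℕ) + (1 - ν / 2)) (by simpa using hσ)
      simp only [zero_add] at e1
      have : 0 ≤ acoef ν (1 - ν / 2) 0 := by simp only [acoef]; positivity
      linarith
    simp only [zero_add]
    nlinarith
  · have d1 := dfun_le h0 h1 hσ s
    have b1 := bfun_le h0 h1 hσ (s + 1)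
    have b2 := bfun_nonneg h0 h1 (x := (s + 1 : ℕ) + (1 - ν / 2)) (by positivity)
    have e : ccoef ν (1 - ν / 2) (n + 1) (s + 1) = acoef ν (1 - ν / 2) (s + 1)
        + bcoef ν (1 - ν / 2) (s + 1 + 1) - bcoef ν (1 - ν / 2) (s + 1) := by
      unfold ccoef
      rw [if_neg (by omega), if_neg (by omega), if_neg (by omega)]
    rw [e]
    unfold ccoef
    rw [if_neg (by omega), if_neg (by omega)]
    split_ifs with h
    · obtain rfl : n = s + 1 := by omega
      simp only [bcoef_succ, acoef_succ]
      linarith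
    · simp only [bcoef_succ, acoef_succ]
      linarith

lemma abel_aux (w e : ℕ → ℝ) (n : ℕ) (hw0 : 0 ≤ w 0) (hw : ∀ s < n, w s ≤ w (s + 1))
    (he : ∀ s ≤ n, 0 ≤ e s) :
    -(w n * e (n + 1)) ≤ ∑ s ∈ Finset.range (n + 1), w s * (e s - e (s + 1)) := by
  induction n with
  | zero =>
    simp only [zero_add, Finset.sum_range_one]
    nlinarith [mul_nonneg hw0 (he 0 le_rfl)]
  | succ n ih =>
    rw [Finset.sum_range_succ]
    have h1 := ih (fun s hs => hw s (by omega)) (fun s hs => he s (by omega))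
    have h2 := mul_le_mul_of_nonneg_right (hw n (by omega)) (he (n + 1) le_rfl)
    linarith

lemma pref_nonneg {ν τ : ℝ} (h1 : ν < 1) (hτ : 0 < τ) :
    0 ≤ τ ^ (-ν) / Real.Gamma (2 - ν) := by
  have : 0 < Real.Gamma (2 - ν) := Real.Gamma_pos_of_pos (by linarith)
  positivity

lemma disc_max {ν τ : ℝ} (h0 : 0 < ν) (h1 : ν < 1) (hτ : 0 < τ) (n : ℕ) (E : ℕ → ℝ)
    (hE : ∀ s ≤ n, E s ≤ E (n + 1)) : 0 ≤ discFracDeriv ν (1 - ν / 2) τ n E := by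
  unfold discFracDeriv
  apply mul_nonneg (pref_nonneg h1 hτ)
  have := abel_aux (fun s => ccoef ν (1 - ν / 2) n (n - s)) (fun s => E (n + 1) - E s) n
    (by simpa using ccoef_last h0 h1 n)
    (fun s hs => by
      have := ccoef_anti h0 h1 n (n - (s + 1)) (by omega)
      rwa [show n - (s + 1) + 1 = n - s by omega] at this)
    (fun s hs => by have := hE s hs; linarith)
  simp only [sub_self, mul_zero, neg_zero] at this
  refine this.trans (le_of_eq (Finset.sum_congr rfl fun s _ => by ring))

lemma alik {ν τ : ℝ} (h0 : 0 < ν) (h1 : ν < 1) (hτ : 0 < τ) (n : ℕ) (y : ℕ → ℝ) :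
    1 / 2 * discFracDeriv ν (1 - ν / 2) τ n (fun s => y s ^ 2)
      ≤ ((1 - ν / 2) * y (n + 1) + (1 - (1 - ν / 2)) * y n)
        * discFracDeriv ν (1 - ν / 2) τ n y := by
  set p := (1 - ν / 2) * y (n + 1) + (1 - (1 - ν / 2)) * y n with hp
  unfold discFracDeriv
  have key : 0 ≤ ∑ s ∈ Finset.range (n + 1), ccoef ν (1 - ν / 2) n (n - s)
      * ((p - y s) ^ 2 - (p - y (s + 1)) ^ 2) := by
    rcases n with _ | n
    · simp only [zero_add, Finset.sum_range_one, Nat.sub_zero]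
      apply mul_nonneg (ccoef_last h0 h1 0)
      have : (p - y 0) ^ 2 - (p - y 1) ^ 2 = (1 - ν) * (y 1 - y 0) ^ 2 := by
        rw [hp]; simp only [zero_add]; ring
      rw [this]
      exact mul_nonneg (by linarith) (sq_nonneg _)
    · rw [Finset.sum_range_succ]
      have h := abel_aux (fun s => ccoef ν (1 - ν / 2) (n + 1) (n + 1 - s))
        (fun s => (p - y s) ^ 2) n
        (by simpa using ccoef_last h0 h1 (n + 1))
        (fun s hs => by
          have := ccoef_anti h0 h1 (n + 1) (n + 1 - (s + 1)) (by omega)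
          rwa [show n + 1 - (s + 1) + 1 = n + 1 - s by omega] at this)
        (fun s hs => sq_nonneg _)
      simp only [Nat.add_sub_cancel_left] at h
      rw [Nat.sub_self]
      have hc := ccoef_zero_one h0 h1 n
      have hc1 : 0 ≤ ccoef ν (1 - ν / 2) (n + 1) 1 := by
        have hmono : ∀ k, k ≤ n → 0 ≤ ccoef ν (1 - ν / 2) (n + 1) (n + 1 - k) := by
          intro k
          induction k with
          | zero => intro _; simpa using ccoef_last h0 h1 (n + 1)
          | succ k ih =>
            intro hk
            have := ccoef_anti h0 h1 (n + 1) (n + 1 - (k + 1)) (by omega)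
            rw [show n + 1 - (k + 1) + 1 = n + 1 - k by omega] at this
            exact (ih (by omega)).trans this
        have := hmono n le_rfl
        simpa using this
      have e1 : (p - y (n + 1)) ^ 2 = (1 - ν / 2) ^ 2 * (y (n + 1 + 1) - y (n + 1)) ^ 2 := by
        rw [hp]; ring
      have e2 : (p - y (n + 1 + 1)) ^ 2 = (ν / 2) ^ 2 * (y (n + 1 + 1) - y (n + 1)) ^ 2 := by
        rw [hp]; ring
      have hc2 : (1 - ν / 2) ^ 2 * ccoef ν (1 - ν / 2) (n + 1) 1
          ≤ (1 - ν) * ccoef ν (1 - ν / 2) (n + 1) 0 := by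
        refine le_trans ?_ hc
        apply mul_le_mul_of_nonneg_right _ hc1
        nlinarith
      have hc3 := mul_le_mul_of_nonneg_right hc2 (sq_nonneg (y (n + 1 + 1) - y (n + 1)))
      rw [e1] at h
      rw [e1, e2]
      linarith
  have e : (p * (τ ^ (-ν) / Real.Gamma (2 - ν) * ∑ s ∈ Finset.range (n + 1),
        ccoef ν (1 - ν / 2) n (n - s) * (y (s + 1) - y s)))
      - 1 / 2 * (τ ^ (-ν) / Real.Gamma (2 - ν) * ∑ s ∈ Finset.range (n + 1),
        ccoef ν (1 - ν / 2) n (n - s) * (y (s + 1) ^ 2 - y s ^ 2))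
      = τ ^ (-ν) / Real.Gamma (2 - ν) * (1 / 2 * ∑ s ∈ Finset.range (n + 1),
        ccoef ν (1 - ν / 2) n (n - s) * ((p - y s) ^ 2 - (p - y (s + 1)) ^ 2)) := by
    simp only [Finset.mul_sum]
    rw [← Finset.sum_sub_distrib]
    exact Finset.sum_congr rfl fun s _ => by ring
  have := mul_nonneg (pref_nonneg h1 hτ) (mul_nonneg (by norm_num : (0:ℝ) ≤ 1 / 2) key)
  linarith

lemma disc_lin (ν σ τ : ℝ) (n : ℕ) (x y : ℕ → ℝ) (p q : ℝ) :
    discFracDeriv ν σ τ n (fun s => p * x s + q * y s)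
      = p * discFracDeriv ν σ τ n x + q * discFracDeriv ν σ τ n y := by
  unfold discFracDeriv
  simp only [Finset.mul_sum]
  rw [← Finset.sum_add_distrib]
  exact Finset.sum_congr rfl fun s _ => by ring

/-- trapezoidal sum -/
noncomputable def TS (N : ℕ) (f : ℕ → ℝ) : ℝ :=
  ∑ i ∈ Finset.range N, (f i + f (i + 1)) / 2 * (1 / (N : ℝ))

lemma disc_TS (ν σ τ : ℝ) (n N : ℕ) (f : ℕ → ℕ → ℝ) :
    discFracDeriv ν σ τ n (fun s => TS N (f s))
      = TS N (fun i => discFracDeriv ν σ τ n (fun s => f s i)) := by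
  unfold discFracDeriv TS
  simp only [← Finset.sum_sub_distrib, Finset.mul_sum]
  rw [Finset.sum_comm]
  refine Finset.sum_congr rfl fun i _ => ?_
  rw [← Finset.sum_add_distrib, Finset.sum_div, Finset.sum_mul]
  exact Finset.sum_congr rfl fun s _ => by ring

lemma TS_split (k : ℕ) (f : ℕ → ℝ) :
    TS (k + 1) f = 1 / ((k + 1 : ℕ) : ℝ) *
      (f 0 / 2 + ∑ i ∈ Finset.range k, f (i + 1) + f (k + 1) / 2) := by
  unfold TS
  rw [← Finset.sum_mul, mul_comm]
  congr 1
  induction k with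
  | zero => simp; ring
  | succ k ih => rw [Finset.sum_range_succ, ih, Finset.sum_range_succ]; ring

lemma TS_mono {N : ℕ} {f g : ℕ → ℝ} (h : ∀ i ≤ N, f i ≤ g i) : TS N f ≤ TS N g := by
  unfold TS
  apply Finset.sum_le_sum
  intro i hi
  rw [Finset.mem_range] at hi
  have h1 := h i (by omega)
  have h2 := h (i + 1) (by omega)
  gcongr

lemma TS_congr {N : ℕ} {f g : ℕ → ℝ} (h : ∀ i ≤ N, f i = g i) : TS N f = TS N g :=
  le_antisymm (TS_mono fun i hi => (h i hi).le) (TS_mono fun i hi => (h i hi).ge)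

lemma TS_const {N : ℕ} (hN : 1 ≤ N) (c : ℝ) : TS N (fun _ => c) = c := by
  unfold TS
  have : (N : ℝ) ≠ 0 := by positivity
  simp
  field_simp

lemma TS_lin (N : ℕ) (f g : ℕ → ℝ) (p q : ℝ) :
    TS N (fun i => p * f i + q * g i) = p * TS N f + q * TS N g := by
  unfold TS
  simp only [Finset.mul_sum]
  rw [← Finset.sum_add_distrib]
  exact Finset.sum_congr rfl fun s _ => by ring

lemma TS_refl (N : ℕ) (f : ℕ → ℝ) : TS N (fun i => f (N - i)) = TS N f := by
  unfold TS
  rw [← Finset.sum_range_reflect]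
  refine Finset.sum_congr rfl fun i hi => ?_
  rw [Finset.mem_range] at hi
  simp only
  rw [show N - (N - 1 - i) = i + 1 by omega, show N - (N - 1 - i + 1) = i by omega, add_comm]

lemma TS_symm (N : ℕ) (f : ℕ → ℝ) :
    TS N f = TS N (fun i => 1 / 2 * f i + 1 / 2 * f (N - i)) := by
  rw [TS_lin N f (fun i => f (N - i)), TS_refl]; ring

lemma TS_le_sum {N : ℕ} (f : ℕ → ℝ) (hf : ∀ i, 0 ≤ f i) (hN : 1 ≤ N) :
    TS N f ≤ ∑ i ∈ Finset.range (N + 1), f i * (1 / (N : ℝ)) := by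
  obtain ⟨k, rfl⟩ : ∃ k, N = k + 1 := ⟨N - 1, by omega⟩
  rw [TS_split, ← Finset.sum_mul, mul_comm, Finset.sum_range_succ, Finset.sum_range_succ']
  have := hf 0
  have := hf (k + 1)
  gcongr ?_ * _
  linarith

lemma sum_le_TS {N : ℕ} (f : ℕ → ℝ) (hf : ∀ i, 0 ≤ f i) (hN : 1 ≤ N) :
    ∑ i ∈ Finset.range (N + 1), f i * (1 / (N : ℝ)) ≤ 2 * TS N f := by
  obtain ⟨k, rfl⟩ : ∃ k, N = k + 1 := ⟨N - 1, by omega⟩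
  rw [TS_split, ← Finset.sum_mul, mul_comm, Finset.sum_range_succ, Finset.sum_range_succ',
    mul_left_comm]
  have : 0 ≤ ∑ i ∈ Finset.range k, f (i + 1) := Finset.sum_nonneg fun i _ => hf _
  gcongr _ * ?_
  linarith

lemma poincare {N : ℕ} (v : ℕ → ℝ) (α : ℝ) (hα : α ≠ 1) (hv : v 0 = α * v N)
    (i : ℕ) (hi : i ≤ N) :
    v i ^ 2 ≤ (2 + 2 * α ^ 2 / (1 - α) ^ 2) *
      (N * ∑ j ∈ Finset.range N, (v (j + 1) - v j) ^ 2) := by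
  set D := N * ∑ j ∈ Finset.range N, (v (j + 1) - v j) ^ 2 with hD
  have h : ∀ i ≤ N, (v i - v 0) ^ 2 ≤ D := by
    intro i hi
    rw [← Finset.sum_range_sub]
    refine sq_sum_le_card_mul_sum_sq.trans ?_
    rw [Finset.card_range, hD]
    have : ∑ j ∈ Finset.range i, (v (j + 1) - v j) ^ 2
        ≤ ∑ j ∈ Finset.range N, (v (j + 1) - v j) ^ 2 :=
      Finset.sum_le_sum_of_subset_of_nonneg (Finset.range_subset_range.2 hi)
        fun _ _ _ => sq_nonneg _
    have h2 : (i : ℝ) ≤ N := by exact_mod_cast hi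
    exact mul_le_mul h2 this (Finset.sum_nonneg fun _ _ => sq_nonneg _) (by positivity)
  have h1 := h i hi
  have h2 := h N le_rfl
  have hpos : 0 < (1 - α) ^ 2 := by
    have : 1 - α ≠ 0 := sub_ne_zero.2 hα.symm
    positivity
  have h3 : (v N) ^ 2 ≤ D / (1 - α) ^ 2 := by
    rw [le_div_iff₀ hpos]
    rw [hv] at h2
    linarith
  have h4 := mul_le_mul_of_nonneg_left h3 (sq_nonneg α)
  have h5 : v 0 ^ 2 ≤ α ^ 2 * (D / (1 - α) ^ 2) := by rw [hv, mul_pow]; exact h4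
  have h6 : v i ^ 2 ≤ 2 * (v i - v 0) ^ 2 + 2 * v 0 ^ 2 := by nlinarith [sq_nonneg (v i - 2 * v 0)]
  calc v i ^ 2 ≤ 2 * D + 2 * (α ^ 2 * (D / (1 - α) ^ 2)) := by linarith
    _ = _ := by ring

lemma sbp (u g : ℕ → ℝ) (k : ℕ) :
    ∑ i ∈ Finset.range k, u (i + 1) * (g (i + 1) - g i) = u (k + 1) * g k - u 0 * g 0
      - ∑ i ∈ Finset.range (k + 1), g i * (u (i + 1) - u i) := by
  induction k with
  | zero => simp; ring
  | succ k ih => rw [Finset.sum_range_succ, ih, Finset.sum_range_succ _ (k + 1)]; ring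

lemma form_lower {N : ℕ} (A d : ℕ → ℝ) (P Q c : ℝ) (hPQ : |Q| < P) 
    (hA : ∀ i, c ≤ A i) (hc : 0 < c) (hs : ∀ i < N, A (N - 1 - i) = A i) :
    (P - |Q|) * c * ∑ i ∈ Finset.range N, d i ^ 2
      ≤ ∑ i ∈ Finset.range N, A i * d i * (P * d i - Q * d (N - 1 - i)) := by
  have h1 : ∑ i ∈ Finset.range N, A i * d (N - 1 - i) ^ 2
      = ∑ i ∈ Finset.range N, A i * d i ^ 2 := by
    rw [← Finset.sum_range_reflect (fun i => A i * d i ^ 2)]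
    refine Finset.sum_congr rfl fun i hi => ?_
    rw [hs i (Finset.mem_range.1 hi)]
  have h2 : ∑ i ∈ Finset.range N, (P * (A i * d i ^ 2) - |Q| / 2 * (A i * d i ^ 2)
      - |Q| / 2 * (A i * d (N - 1 - i) ^ 2))
      ≤ ∑ i ∈ Finset.range N, A i * d i * (P * d i - Q * d (N - 1 - i)) := by
    apply Finset.sum_le_sum
    intro i hi
    have hA0 : 0 ≤ A i := hc.le.trans (hA i)
    have h3 : Q * (d i * d (N - 1 - i)) ≤ |Q| * ((d i ^ 2 + d (N - 1 - i) ^ 2) / 2) := by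
      refine (le_abs_self _).trans ?_
      rw [abs_mul]
      gcongr
      rw [abs_le]
      constructor <;> nlinarith [sq_nonneg (d i + d (N - 1 - i)), sq_nonneg (d i - d (N - 1 - i))]
    have h4 := mul_le_mul_of_nonneg_left h3 hA0
    linarith
  rw [Finset.sum_sub_distrib, Finset.sum_sub_distrib, ← Finset.mul_sum, ← Finset.mul_sum,
    ← Finset.mul_sum, h1] at h2
  have h5 : c * ∑ i ∈ Finset.range N, d i ^ 2 ≤ ∑ i ∈ Finset.range N, A i * d i ^ 2 := by
    rw [Finset.mul_sum]
    exact Finset.sum_le_sum fun i _ => mul_le_mul_of_nonneg_right (hA i) (sq_nonneg _)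
  have h6 := mul_le_mul_of_nonneg_left h5 (by linarith : 0 ≤ P - |Q|)
  linarith

lemma energy_level (N : ℕ) (hN : 1 ≤ N) (α β γ c s P Q ρ : ℝ) (v Dz a ψ : ℕ → ℝ)
    (hc : 0 < c) (ha : ∀ i, c ≤ a i) (hsym : ∀ i ∈ Finset.Icc 1 N, a i = a (N + 1 - i))
    (hPQ : |Q| < P) (hP1 : P + Q * α = s) (hP2 : P * α + Q = s * β) (hγ : s * γ ≤ 0)
    (hint : ∀ i, 1 ≤ i → i ≤ N - 1 →
      Dz i - (a (i + 1) * v (i + 1) - (a (i + 1) + a i) * v i + a i * v (i - 1))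
        / (1 / (N : ℝ)) ^ 2 = ψ i)
    (hb1 : v 0 = α * v N)
    (hb2 : β * Dz 0 + Dz N + (2 / (1 / (N : ℝ))) *
        (a N * ((v N - v (N - 1)) / (1 / (N : ℝ))) - β * a 1 * ((v 1 - v 0) / (1 / (N : ℝ)))
          - γ * v N) = (2 / (1 / (N : ℝ))) * ρ + ψ N + β * ψ 0) :
    TS N (fun i => (P * v i + Q * v (N - i)) * Dz i)
      + (P - |Q|) * c * (N * ∑ j ∈ Finset.range N, (v (j + 1) - v j) ^ 2)
      ≤ TS N (fun i => (P * v i + Q * v (N - i)) * ψ i) + s * v N * ρ := by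
  obtain ⟨k, rfl⟩ : ∃ k, N = k + 1 := ⟨N - 1, by omega⟩
  set N : ℝ := ((k + 1 : ℕ) : ℝ) with hNd
  have hN0 : 0 < N := by rw [hNd]; positivity
  set u : ℕ → ℝ := fun i => P * v i + Q * v (k + 1 - i) with hu
  set g : ℕ → ℝ := fun i => a (i + 1) * (v (i + 1) - v i) with hg
  have hform := form_lower (N := k + 1) (fun i => a (i + 1)) (fun i => v (i + 1) - v i) P Q c hPQ
    (fun i => ha _) hc (fun i hi => by
      have := hsym (i + 1) (by rw [Finset.mem_Icc]; omega)
      rw [this]; congr 1; omega)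
  have hform' : ∑ i ∈ Finset.range (k + 1), a (i + 1) * (v (i + 1) - v i) *
      (P * (v (i + 1) - v i) - Q * (v (k + 1 - 1 - i + 1) - v (k + 1 - 1 - i)))
      = ∑ i ∈ Finset.range (k + 1), g i * (u (i + 1) - u i) := by
    refine Finset.sum_congr rfl fun i hi => ?_
    rw [Finset.mem_range] at hi
    simp only [hg, hu]
    rw [show k + 1 - 1 - i + 1 = k + 1 - i by omega, show k + 1 - (i + 1) = k + 1 - 1 - i by omega]
    ring
  rw [hform'] at hform
  have hsb := sbp u g k
  have hD : ∑ i ∈ Finset.range k, u (i + 1) * Dz (i + 1)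
      = ∑ i ∈ Finset.range k, u (i + 1) * ψ (i + 1)
        + N ^ 2 * ∑ i ∈ Finset.range k, u (i + 1) * (g (i + 1) - g i) := by
    rw [Finset.mul_sum, ← Finset.sum_add_distrib]
    refine Finset.sum_congr rfl fun i hi => ?_
    rw [Finset.mem_range] at hi
    have := hint (i + 1) (by omega) (by omega)
    rw [← this, Nat.add_sub_cancel]
    simp only [hg]
    field_simp
    ring
  have hu0 : u 0 = s * β * v (k + 1) := by
    simp only [hu, Nat.sub_zero]; rw [hb1, ← hP2]; ring
  have huN : u (k + 1) = s * v (k + 1) := by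
    simp only [hu, Nat.sub_self]; rw [hb1, ← hP1]; ring
  have hB : u 0 * Dz 0 + u (k + 1) * Dz (k + 1) = u 0 * ψ 0 + u (k + 1) * ψ (k + 1)
      + 2 * N * (s * v (k + 1) * ρ) + 2 * N * (s * γ * v (k + 1) ^ 2)
      - 2 * N ^ 2 * (u (k + 1) * g k - u 0 * g 0) := by
    rw [hu0, huN]
    simp only [hg, zero_add]
    rw [Nat.add_sub_cancel] at hb2
    have e : β * Dz 0 + Dz (k + 1) = 2 * N * ρ + ψ (k + 1) + β * ψ 0
        - 2 * N * (a (k + 1) * ((v (k + 1) - v k) * N) - β * a 1 * ((v 1 - v 0) * N)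
          - γ * v (k + 1)) := by
      simp only [one_div, div_inv_eq_mul] at hb2
      linarith
    linear_combination (s * v (k + 1)) * e
  have hsg : s * γ * v (k + 1) ^ 2 ≤ 0 := mul_nonpos_of_nonpos_of_nonneg hγ (sq_nonneg _)
  rw [TS_split, TS_split]
  simp only [← hNd]
  have h1 := mul_le_mul_of_nonneg_left hform hN0.le
  have e : 1 / N * (u 0 * Dz 0 / 2 + ∑ i ∈ Finset.range k, u (i + 1) * Dz (i + 1)
        + u (k + 1) * Dz (k + 1) / 2)
      = 1 / N * (u 0 * ψ 0 / 2 + ∑ i ∈ Finset.range k, u (i + 1) * ψ (i + 1)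
        + u (k + 1) * ψ (k + 1) / 2) + s * v (k + 1) * ρ + s * γ * v (k + 1) ^ 2
        - N * ∑ i ∈ Finset.range (k + 1), g i * (u (i + 1) - u i) := by
    rw [hD, hsb]
    field_simp
    linear_combination hB
  simp only [hu] at e ⊢
  rw [e]
  linarith

lemma PQ_exists (α β γ : ℝ)
    (hcase : (|α| < 1 ∧ |β| < 1 ∧ γ ≤ 0) ∨ (|α| > 1 ∧ |β| > 1 ∧ α * β * γ ≤ 0)) :
    ∃ s P Q : ℝ, |Q| < P ∧ P + Q * α = s ∧ P * α + Q = s * β ∧ s * γ ≤ 0 ∧ s ^ 2 = 1 ∧ α ≠ 1 := by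
  have key : ∃ s : ℝ, s ^ 2 = 1 ∧ s * γ ≤ 0 ∧ 0 < s * (1 - α * β) / (1 - α ^ 2) ∧
      1 - α ^ 2 ≠ 0 ∧ 0 < (1 - α ^ 2) * (1 - β ^ 2) := by
    rcases hcase with ⟨h1, h2, h3⟩ | ⟨h1, h2, h3⟩
    · have a1 : α ^ 2 < 1 := by rw [sq_lt_one_iff_abs_lt_one]; exact h1
      have b1 : β ^ 2 < 1 := by rw [sq_lt_one_iff_abs_lt_one]; exact h2
      refine ⟨1, by norm_num, by linarith, ?_, by linarith, mul_pos (by linarith) (by linarith)⟩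
      apply div_pos _ (by linarith)
      nlinarith [sq_nonneg (α - β)]
    · have a1 : 1 < α ^ 2 := by rw [one_lt_sq_iff_one_lt_abs]; exact h1
      have b1 : 1 < β ^ 2 := by rw [one_lt_sq_iff_one_lt_abs]; exact h2
      have ab : 1 < (α * β) ^ 2 := by rw [mul_pow]; nlinarith
      have hp : 0 < (1 - α ^ 2) * (1 - β ^ 2) := mul_pos_of_neg_of_neg (by linarith) (by linarith)
      rw [one_lt_sq_iff_one_lt_abs] at ab
      rcases lt_abs.1 ab with h | h
      · refine ⟨1, by norm_num, ?_, div_pos_of_neg_of_neg (by linarith) (by linarith),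
          by linarith, hp⟩
        by_contra hh
        nlinarith
      · refine ⟨-1, by norm_num, ?_, div_pos_of_neg_of_neg (by linarith) (by linarith),
          by linarith, hp⟩
        by_contra hh
        nlinarith
  obtain ⟨s, hs, hsg, hP, hα, hp⟩ := key
  refine ⟨s, s * (1 - α * β) / (1 - α ^ 2), s * (β - α) / (1 - α ^ 2), ?_, ?_, ?_, hsg, hs, ?_⟩
  · apply abs_lt_of_sq_lt_sq _ hP.le
    rw [div_pow, div_pow]
    have : 0 < (1 - α ^ 2) ^ 2 := by positivity
    apply div_lt_div_of_pos_right _ this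
    rw [mul_pow, mul_pow, hs]
    linarith
  · field_simp; ring
  · field_simp; ring
  · rintro rfl; norm_num at hα

/-- the energy -/
noncomputable def En (N : ℕ) (P Q : ℝ) (v : ℕ → ℝ) : ℝ :=
  TS N (fun i => (P + Q) / 4 * (v i + v (N - i)) ^ 2 + (P - Q) / 4 * (v i - v (N - i)) ^ 2)

lemma TS_nonneg {N : ℕ} {f : ℕ → ℝ} (h : ∀ i ≤ N, 0 ≤ f i) : 0 ≤ TS N f := by
  have := TS_mono (f := fun _ => 0) h
  refine le_trans (le_of_eq ?_) this
  simp [TS]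

lemma En_alik {ν τ : ℝ} (h0 : 0 < ν) (h1 : ν < 1) (hτ : 0 < τ) (N n : ℕ) (P Q : ℝ)
    (hPQ : |Q| < P) (z : ℕ → ℕ → ℝ) :
    1 / 2 * discFracDeriv ν (1 - ν / 2) τ n (fun s => En N P Q (z s))
      ≤ TS N (fun i => (P * ysig (1 - ν / 2) z n i + Q * ysig (1 - ν / 2) z n (N - i))
          * discFracDeriv ν (1 - ν / 2) τ n (fun s => z s i)) := by
  obtain ⟨q1, q2⟩ := abs_lt.1 hPQ
  unfold En
  rw [disc_TS, TS_symm N (fun i => (P * ysig (1 - ν / 2) z n i + Q * ysig (1 - ν / 2) z n (N - i))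
          * discFracDeriv ν (1 - ν / 2) τ n (fun s => z s i))]
  have e0 := TS_lin N (fun i => discFracDeriv ν (1 - ν / 2) τ n (fun s =>
    (P + Q) / 4 * (z s i + z s (N - i)) ^ 2 + (P - Q) / 4 * (z s i - z s (N - i)) ^ 2))
    (fun _ => 0) (1 / 2) 0
  simp only [mul_zero, zero_mul, add_zero] at e0
  rw [← e0]
  apply TS_mono
  intro i hi
  rw [disc_lin ν _ τ n (fun s => (z s i + z s (N - i)) ^ 2) (fun s => (z s i - z s (N - i)) ^ 2)]
  have a1 := alik h0 h1 hτ n (fun s => z s i + z s (N - i))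
  have a2 := alik h0 h1 hτ n (fun s => z s i - z s (N - i))
  have l1 := disc_lin ν (1 - ν / 2) τ n (fun s => z s i) (fun s => z s (N - i)) 1 1
  have l2 := disc_lin ν (1 - ν / 2) τ n (fun s => z s i) (fun s => z s (N - i)) 1 (-1)
  simp only [one_mul, neg_mul, ← sub_eq_add_neg] at l1 l2
  rw [l1] at a1
  rw [l2] at a2
  have b1 := mul_le_mul_of_nonneg_left a1 (by linarith : 0 ≤ (P + Q) / 4)
  have b2 := mul_le_mul_of_nonneg_left a2 (by linarith : 0 ≤ (P - Q) / 4)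
  rw [show N - (N - i) = i by omega]
  unfold ysig
  linarith

lemma En_upper {N : ℕ} (hN : 1 ≤ N) (P Q : ℝ) (hPQ : |Q| < P) (v : ℕ → ℝ) (B : ℝ)
    (hv : ∀ i ≤ N, v i ^ 2 ≤ B) : En N P Q v ≤ 2 * P * B := by
  obtain ⟨q1, q2⟩ := abs_lt.1 hPQ
  rw [← TS_const hN (2 * P * B)]
  apply TS_mono
  intro i hi
  have h1 := hv i hi
  have h2 := hv (N - i) (by omega)
  have a1 : (v i + v (N - i)) ^ 2 ≤ 4 * B := by nlinarith [sq_nonneg (v i - v (N - i))]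
  have a2 : (v i - v (N - i)) ^ 2 ≤ 4 * B := by nlinarith [sq_nonneg (v i + v (N - i))]
  have b1 := mul_le_mul_of_nonneg_left a1 (by linarith : 0 ≤ (P + Q) / 4)
  have b2 := mul_le_mul_of_nonneg_left a2 (by linarith : 0 ≤ (P - Q) / 4)
  linarith

lemma En_lower {N : ℕ} (hN : 1 ≤ N) (P Q : ℝ) (hPQ : |Q| < P) (v : ℕ → ℝ) :
    (P - |Q|) / 2 * ∑ i ∈ Finset.range (N + 1), v i ^ 2 * (1 / (N : ℝ)) ≤ En N P Q v := by
  have h1 := sum_le_TS (fun i => v i ^ 2) (fun i => sq_nonneg _) hN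
  have h2 : (P - |Q|) * TS N (fun i => v i ^ 2) ≤ En N P Q v := by
    have e0 := TS_lin N (fun i => 1 / 2 * v i ^ 2 + 1 / 2 * v (N - i) ^ 2)
      (fun _ => 0) (P - |Q|) 0
    simp only [mul_zero, zero_mul, add_zero] at e0
    rw [TS_symm N (fun i => v i ^ 2), ← e0]
    apply TS_mono
    intro i hi
    have b1 := mul_nonneg (by linarith [neg_abs_le Q] : 0 ≤ |Q| + Q) (sq_nonneg (v i + v (N - i)))
    have b2 := mul_nonneg (by linarith [le_abs_self Q] : 0 ≤ |Q| - Q) (sq_nonneg (v i - v (N - i)))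
    nlinarith
  have h3 := mul_le_mul_of_nonneg_left h1 (by linarith : 0 ≤ (P - |Q|) / 2)
  linarith

lemma En_sig {N : ℕ} {ν : ℝ} (h0 : 0 < ν) (h1 : ν < 1) (P Q : ℝ) (hPQ : |Q| < P)
    (z : ℕ → ℕ → ℝ) (n : ℕ) (hle : En N P Q (z n) ≤ En N P Q (z (n + 1))) :
    (1 - ν) ^ 2 * En N P Q (z (n + 1)) ≤ En N P Q (fun i => ysig (1 - ν / 2) z n i) := by
  obtain ⟨q1, q2⟩ := abs_lt.1 hPQ
  have h : (1 - ν) * (1 - ν / 2) * En N P Q (z (n + 1)) + (-((1 - ν) * (ν / 2))) * En N P Q (z n)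
      ≤ En N P Q (fun i => ysig (1 - ν / 2) z n i) := by
    unfold En
    rw [← TS_lin]
    apply TS_mono
    intro i hi
    have key : ∀ x y : ℝ, (1 - ν) * (1 - ν / 2) * x ^ 2 - ((1 - ν) * (ν / 2)) * y ^ 2
        ≤ ((1 - ν / 2) * x + (ν / 2) * y) ^ 2 := by
      intro x y
      have : 0 ≤ (1 - ν / 2) * (ν / 2) * (x + y) ^ 2 :=
        mul_nonneg (mul_nonneg (by linarith) (by linarith)) (sq_nonneg _)
      nlinarith
    have a1 := key (z (n + 1) i + z (n + 1) (N - i)) (z n i + z n (N - i))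
    have a2 := key (z (n + 1) i - z (n + 1) (N - i)) (z n i - z n (N - i))
    have b1 := mul_le_mul_of_nonneg_left a1 (by linarith : 0 ≤ (P + Q) / 4)
    have b2 := mul_le_mul_of_nonneg_left a2 (by linarith : 0 ≤ (P - Q) / 4)
    unfold ysig
    linarith
  have h2 := mul_le_mul_of_nonneg_left hle
    (mul_nonneg (by linarith) (by linarith) : 0 ≤ (1 - ν) * (ν / 2))
  linarith

lemma rhs_bound {N : ℕ} (hN : 1 ≤ N) (P Q s ρ δ B : ℝ) (hPQ : |Q| < P) (hs : s ^ 2 = 1)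
    (hδ : 0 < δ) (v ψ : ℕ → ℝ) (hv : ∀ i ≤ N, v i ^ 2 ≤ B) :
    TS N (fun i => (P * v i + Q * v (N - i)) * ψ i) + s * v N * ρ
      ≤ δ * ((4 * P ^ 2 + 1) * B) + 1 / (4 * δ) *
        ((∑ i ∈ Finset.range (N + 1), ψ i ^ 2 * (1 / (N : ℝ))) + ρ ^ 2) := by
  have young : ∀ x y : ℝ, x * y ≤ δ * x ^ 2 + 1 / (4 * δ) * y ^ 2 := by
    intro x y
    have : δ * x ^ 2 + 1 / (4 * δ) * y ^ 2 - x * y = (2 * δ * x - y) ^ 2 / (4 * δ) := by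
      field_simp; ring
    have h2 : 0 ≤ (2 * δ * x - y) ^ 2 / (4 * δ) := by positivity
    linarith
  have h1 : TS N (fun i => (P * v i + Q * v (N - i)) * ψ i)
      ≤ δ * (4 * P ^ 2 * B) + 1 / (4 * δ) * TS N (fun i => ψ i ^ 2) := by
    rw [← TS_const hN (4 * P ^ 2 * B), ← TS_lin]
    apply TS_mono
    intro i hi
    refine (young _ _).trans ?_
    have h1 := hv i hi
    have h2 := hv (N - i) (by omega)
    have hQ : Q ^ 2 ≤ P ^ 2 := sq_le_sq' (by linarith [(abs_lt.1 hPQ).1]) (abs_lt.1 hPQ).2.le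
    have h3 : (P * v i + Q * v (N - i)) ^ 2 ≤ 4 * P ^ 2 * B := by
      have a1 := mul_le_mul_of_nonneg_left h1 (sq_nonneg P)
      have a2 := mul_le_mul hQ h2 (sq_nonneg _) (sq_nonneg P)
      nlinarith [sq_nonneg (P * v i - Q * v (N - i))]
    gcongr
  have h2 := TS_le_sum (fun i => ψ i ^ 2) (fun i => sq_nonneg _) hN
  have h3 := mul_le_mul_of_nonneg_left h2 (by positivity : 0 ≤ 1 / (4 * δ))
  have h4 := young (s * v N) ρ
  have h5 : (s * v N) ^ 2 ≤ B := by rw [mul_pow, hs, one_mul]; exact hv N le_rfl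
  have h6 := mul_le_mul_of_nonneg_left h5 hδ.le
  linarith

/-- Theorem 5, convergence: Suppose either (1) `|α| < 1`, `|β| < 1`,
`γ ≤ 0`, or (2) `|α| > 1`, `|β| > 1`, `αβγ ≤ 0`, and `a_i^n ≥ c₁ > 0` with
`a_i^n = a_{N+1−i}^n`. If `z` solves the error scheme with truncation errors `ψ_i^n`
(interior) and `ρ^n` (boundary) and zero initial data, then there is `M₃ > 0` depending
only on `α`, `β`, `c₁` (independent of `h`, `τ`, `T`) with
`|[z^{n+1}]|₀² ≤ M₃·max_{0≤m≤N_T−1}(|[ψ^m]|₀² + (ρ^m)²)`; in particular, if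
`|ψ_i^n| ≤ C(h²+τ²)` and `|ρ^n| ≤ C(h²+τ²)`, then
`|[z^{n+1}]|₀ ≤ √(3M₃)·C·(h²+τ²)`, i.e., the scheme converges in the discrete
`L₂`-norm with rate `O(h²+τ²)`. Here `h = 1/N`, `τ = T/N_T`, `σ = 1−ν/2`. -/
theorem discrete_convergence (ν α β γ c₁ : ℝ)
    (hν0 : 0 < ν) (hν1 : ν < 1) (hc₁ : 0 < c₁)
    (hcase : (|α| < 1 ∧ |β| < 1 ∧ γ ≤ 0) ∨ (|α| > 1 ∧ |β| > 1 ∧ α * β * γ ≤ 0)) :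
    ∃ M₃ > 0, ∀ (N NT : ℕ) (T : ℝ) (z a ψ : ℕ → ℕ → ℝ) (ρ : ℕ → ℝ)
      (hN : 1 ≤ N) (hNT : 1 ≤ NT) (hT : 0 < T),
      (∀ n i, c₁ ≤ a n i) →
      -- symmetry of the coefficients: a_i^n = a_{N+1-i}^n
      (∀ n, ∀ i ∈ Finset.Icc 1 N, a n i = a n (N + 1 - i)) →
      -- interior equations of the error scheme
      (∀ n < NT, ∀ i, 1 ≤ i → i ≤ N - 1 →
        discFracDeriv ν (1 - ν / 2) (T / (NT : ℝ)) n (fun s => z s i)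
            - (a n (i + 1) * ysig (1 - ν / 2) z n (i + 1)
                - (a n (i + 1) + a n i) * ysig (1 - ν / 2) z n i
                + a n i * ysig (1 - ν / 2) z n (i - 1)) / (1 / (N : ℝ)) ^ 2
          = ψ n i) →
      -- first nonlocal boundary condition
      (∀ n < NT, z (n + 1) 0 = α * z (n + 1) N) →
      -- second nonlocal boundary condition with truncation error ρ^n
      (∀ n < NT,
        β * discFracDeriv ν (1 - ν / 2) (T / (NT : ℝ)) n (fun s => z s 0)
            + discFracDeriv ν (1 - ν / 2) (T / (NT : ℝ)) n (fun s => z s N)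
            + (2 / (1 / (N : ℝ))) *
                (a n N * ((ysig (1 - ν / 2) z n N - ysig (1 - ν / 2) z n (N - 1))
                    / (1 / (N : ℝ)))
                  - β * a n 1 * ((ysig (1 - ν / 2) z n 1 - ysig (1 - ν / 2) z n 0)
                    / (1 / (N : ℝ)))
                  - γ * ysig (1 - ν / 2) z n N)
          = (2 / (1 / (N : ℝ))) * ρ n + ψ n N + β * ψ n 0) →
      -- zero initial data
      (∀ i ≤ N, z 0 i = 0) →
      -- stability estimate for the error
      (∀ n < NT,
        (∑ i ∈ Finset.range (N + 1), (z (n + 1) i) ^ 2 * (1 / (N : ℝ)))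
          ≤ M₃ * (Finset.range NT).sup'
              (Finset.nonempty_range_iff.mpr (by omega))
              (fun m =>
                (∑ i ∈ Finset.range (N + 1), (ψ m i) ^ 2 * (1 / (N : ℝ)))
                  + (ρ m) ^ 2)) ∧
      -- in particular: convergence with rate O(h² + τ²)
      ∀ C : ℝ, 0 ≤ C →
        (∀ n < NT, ∀ i ≤ N,
          |ψ n i| ≤ C * ((1 / (N : ℝ)) ^ 2 + (T / (NT : ℝ)) ^ 2)) →
        (∀ n < NT, |ρ n| ≤ C * ((1 / (N : ℝ)) ^ 2 + (T / (NT : ℝ)) ^ 2)) →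
        ∀ n < NT,
          Real.sqrt (∑ i ∈ Finset.range (N + 1), (z (n + 1) i) ^ 2 * (1 / (N : ℝ)))
            ≤ Real.sqrt (3 * M₃) * C * ((1 / (N : ℝ)) ^ 2 + (T / (NT : ℝ)) ^ 2) := by
  obtain ⟨s, P, Q, hPQ, hP1, hP2, hsγ, hs, hα⟩ := PQ_exists α β γ hcase
  have hP : 0 < P := lt_of_le_of_lt (abs_nonneg Q) hPQ
  obtain ⟨K, hK⟩ : ∃ K : ℝ, K = 2 + 2 * α ^ 2 / (1 - α) ^ 2 := ⟨_, rfl⟩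
  have hK0 : 0 < K := by rw [hK]; positivity
  have hpq : 0 < P - |Q| := by linarith
  obtain ⟨κ, hκ⟩ : ∃ κ : ℝ, κ = (P - |Q|) * c₁ := ⟨_, rfl⟩
  have hκ0 : 0 < κ := by rw [hκ]; positivity
  obtain ⟨δ, hδ⟩ : ∃ δ : ℝ, δ = κ / (2 * K * (4 * P ^ 2 + 1)) := ⟨_, rfl⟩
  have hδ0 : 0 < δ := by rw [hδ]; positivity
  have hδ' : δ * ((4 * P ^ 2 + 1) * K) = κ / 2 := by rw [hδ]; field_simp
  have hν : 0 < 1 - ν := by linarith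
  obtain ⟨M, hM⟩ : ∃ M : ℝ, M = 2 * P * K / ((P - |Q|) * (1 - ν) ^ 2 * δ * κ) := ⟨_, rfl⟩
  have hM0 : 0 < M := by rw [hM]; positivity
  refine ⟨M, hM0, ?_⟩
  intro N NT T z a ψ ρ hN hNT hT ha hsym hint hb1 hb2 hz0
  have hτ : 0 < T / (NT : ℝ) := by
    have : 0 < (NT : ℝ) := by exact_mod_cast hNT
    positivity
  have hbd : ∀ n ≤ NT, z n 0 = α * z n N := by
    intro n hn
    rcases n with _ | n
    · rw [hz0 0 (by omega), hz0 N le_rfl]; ring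
    · exact hb1 n (by omega)
  have hE0 : En N P Q (z 0) = 0 := by
    have : En N P Q (z 0) = TS N (fun _ => 0) := by
      apply TS_congr
      intro i hi
      rw [hz0 i hi, hz0 (N - i) (by omega)]; ring
    rw [this, TS_const hN]
  have hEn : ∀ n, 0 ≤ En N P Q (z n) := by
    intro n
    refine le_trans ?_ (En_lower hN P Q hPQ (z n))
    have : 0 ≤ ∑ i ∈ Finset.range (N + 1), z n i ^ 2 * (1 / (N : ℝ)) :=
      Finset.sum_nonneg fun i _ => by positivity
    positivity
  have main : ∀ n < NT,
        (∑ i ∈ Finset.range (N + 1), (z (n + 1) i) ^ 2 * (1 / (N : ℝ)))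
          ≤ M * (Finset.range NT).sup'
              (Finset.nonempty_range_iff.mpr (by omega))
              (fun m =>
                (∑ i ∈ Finset.range (N + 1), (ψ m i) ^ 2 * (1 / (N : ℝ)))
                  + (ρ m) ^ 2) := by
    intro n hn
    obtain ⟨m, hm, hmax⟩ := Finset.exists_max_image (Finset.range NT)
      (fun m => En N P Q (z (m + 1))) ⟨n, Finset.mem_range.2 hn⟩
    rw [Finset.mem_range] at hm
    have hmax' : ∀ r ≤ NT, En N P Q (z r) ≤ En N P Q (z (m + 1)) := by
      intro r hr
      rcases r with _ | r
      · rw [hE0]; exact hEn _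
      · exact hmax r (Finset.mem_range.2 (by omega))
    obtain ⟨S, hS⟩ : ∃ S : ℝ, S = (∑ i ∈ Finset.range (N + 1), (ψ m i) ^ 2 * (1 / (N : ℝ)))
                  + (ρ m) ^ 2 := ⟨_, rfl⟩
    have hsup : S ≤ (Finset.range NT).sup'
              (Finset.nonempty_range_iff.mpr (by omega))
              (fun m =>
                (∑ i ∈ Finset.range (N + 1), (ψ m i) ^ 2 * (1 / (N : ℝ)))
                  + (ρ m) ^ 2) := by
      rw [hS]
      exact Finset.le_sup' (fun m =>
                (∑ i ∈ Finset.range (N + 1), (ψ m i) ^ 2 * (1 / (N : ℝ)))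
                  + (ρ m) ^ 2) (Finset.mem_range.2 hm)
    refine le_trans ?_ (mul_le_mul_of_nonneg_left hsup hM0.le)
    have hv0 : ysig (1 - ν / 2) z m 0 = α * ysig (1 - ν / 2) z m N := by
      unfold ysig
      rw [hbd m (by omega), hbd (m + 1) (by omega)]; ring
    obtain ⟨D, hD⟩ : ∃ D : ℝ, D = N * ∑ j ∈ Finset.range N,
      (ysig (1 - ν / 2) z m (j + 1) - ysig (1 - ν / 2) z m j) ^ 2 := ⟨_, rfl⟩
    have hpc : ∀ i ≤ N, ysig (1 - ν / 2) z m i ^ 2 ≤ K * D := by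
      intro i hi
      rw [hK, hD]
      exact poincare (fun i => ysig (1 - ν / 2) z m i) α hα hv0 i hi
    have h1 := energy_level N hN α β γ c₁ s P Q (ρ m) (fun i => ysig (1 - ν / 2) z m i)
      (fun i => discFracDeriv ν (1 - ν / 2) (T / (NT : ℝ)) m (fun s => z s i)) (a m) (ψ m)
      hc₁ (ha m) (hsym m) hPQ hP1 hP2 hsγ (hint m hm) hv0 (hb2 m hm)
    have h2 := rhs_bound hN P Q s (ρ m) δ (K * D) hPQ hs hδ0
      (fun i => ysig (1 - ν / 2) z m i) (ψ m) hpc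
    have h3 := En_alik hν0 hν1 hτ N m P Q hPQ z
    have h4 := disc_max hν0 hν1 hτ m (fun s => En N P Q (z s)) (fun r hr => hmax' r (by omega))
    rw [← hD, ← hκ] at h1
    rw [← hS] at h2
    have h5 : κ / 2 * D ≤ 1 / (4 * δ) * S := by
      have : δ * ((4 * P ^ 2 + 1) * (K * D)) = κ / 2 * D := by rw [← hδ']; ring
      linarith
    have h6 : D ≤ S / (2 * δ * κ) := by
      rw [le_div_iff₀ (by positivity)]
      have := mul_le_mul_of_nonneg_left h5 (by positivity : 0 ≤ 4 * δ)
      have e : 4 * δ * (1 / (4 * δ) * S) = S := by field_simp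
      rw [e] at this
      linarith
    have h7 := En_sig (N := N) hν0 hν1 P Q hPQ z m (hmax' m (by omega))
    have h8 := En_upper hN P Q hPQ (fun i => ysig (1 - ν / 2) z m i) (K * D) hpc
    have h9 := En_lower hN P Q hPQ (z (n + 1))
    have h10 := hmax' (n + 1) (by omega)
    have h11 : (1 - ν) ^ 2 * ((P - |Q|) / 2 *
        ∑ i ∈ Finset.range (N + 1), z (n + 1) i ^ 2 * (1 / (N : ℝ)))
        ≤ 2 * P * (K * (S / (2 * δ * κ))) := by
      refine le_trans (mul_le_mul_of_nonneg_left (h9.trans h10) (sq_nonneg _)) ?_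
      refine (h7.trans h8).trans ?_
      gcongr
    have e : M * S = 2 * P * (K * (S / (2 * δ * κ))) / ((1 - ν) ^ 2 * ((P - |Q|) / 2)) := by
      rw [hM]
      have : P - |Q| ≠ 0 := hpq.ne'
      have : 1 - ν ≠ 0 := hν.ne'
      field_simp
    rw [e, le_div_iff₀ (by positivity)]
    linarith
  refine ⟨main, ?_⟩
  intro C hC hψ hρ n hn
  obtain ⟨H, hH⟩ : ∃ H : ℝ, H = (1 / (N : ℝ)) ^ 2 + (T / (NT : ℝ)) ^ 2 := ⟨_, rfl⟩
  rw [← hH] at hψ hρ ⊢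
  have hH0 : 0 ≤ H := by rw [hH]; positivity
  have hle : (Finset.range NT).sup'
              (Finset.nonempty_range_iff.mpr (by omega))
              (fun m =>
                (∑ i ∈ Finset.range (N + 1), (ψ m i) ^ 2 * (1 / (N : ℝ)))
                  + (ρ m) ^ 2) ≤ 3 * (C * H) ^ 2 := by
    apply Finset.sup'_le
    intro m hm
    rw [Finset.mem_range] at hm
    have b1 : (ρ m) ^ 2 ≤ (C * H) ^ 2 := sq_le_sq' (abs_le.1 (hρ m hm)).1 (abs_le.1 (hρ m hm)).2
    have b2 : ∑ i ∈ Finset.range (N + 1), (ψ m i) ^ 2 * (1 / (N : ℝ))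
        ≤ ∑ i ∈ Finset.range (N + 1), (C * H) ^ 2 * (1 / (N : ℝ)) := by
      apply Finset.sum_le_sum
      intro i hi
      rw [Finset.mem_range] at hi
      have := hψ m hm i (by omega)
      have := sq_le_sq' (abs_le.1 this).1 (abs_le.1 this).2
      gcongr
    have b3 : ∑ i ∈ Finset.range (N + 1), (C * H) ^ 2 * (1 / (N : ℝ)) ≤ 2 * (C * H) ^ 2 := by
      rw [Finset.sum_const, Finset.card_range, nsmul_eq_mul]
      have hN' : (1 : ℝ) ≤ N := by exact_mod_cast hN
      have : ((N + 1 : ℕ) : ℝ) * (1 / (N : ℝ)) ≤ 2 := by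
        rw [mul_one_div, div_le_iff₀ (by linarith)]; push_cast; linarith
      calc ((N + 1 : ℕ) : ℝ) * ((C * H) ^ 2 * (1 / (N : ℝ)))
          = (((N + 1 : ℕ) : ℝ) * (1 / (N : ℝ))) * (C * H) ^ 2 := by ring
        _ ≤ 2 * (C * H) ^ 2 := mul_le_mul_of_nonneg_right this (sq_nonneg _)
    linarith
  have h1 := (main n hn).trans (mul_le_mul_of_nonneg_left hle hM0.le)
  refine (Real.sqrt_le_sqrt h1).trans (le_of_eq ?_)
  rw [show M * (3 * (C * H) ^ 2) = 3 * M * (C * H) ^ 2 by ring,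
    Real.sqrt_mul (by positivity), Real.sqrt_sq (by positivity), mul_assoc]
end

section
/- Let E ≥ 0 and let (w_n)_{n≥0} be a sequence of nonnegative real numbers with w₀ ≤ E. Suppose for each n ≥ 0 we are given real numbers g₀^{n+1}, g₁^{n+1}, …, g_n^{n+1} satisfying 0 < g₀^{n+1} ≤ g₁^{n+1} ≤ … ≤ g_n^{n+1}, and the recurrence inequality g_n^{n+1}·w_{n+1} ≤ Σ_{s=1}^n (g_s^{n+1} − g_{s−1}^{n+1})·w_s + g₀^{n+1}·E holds. Then w_n ≤ E for all n ≥ 0. -/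
open scoped BigOperators

/-- Discrete Gronwall-type induction. Let `E ≥ 0`, `(w_n)` nonnegative with
`w₀ ≤ E`, and for each `n ≥ 0` coefficients `0 < g₀^{n+1} ≤ g₁^{n+1} ≤ … ≤ g_n^{n+1}`
satisfying `g_n^{n+1}·w_{n+1} ≤ Σ_{s=1}^n (g_s^{n+1} − g_{s−1}^{n+1})·w_s + g₀^{n+1}·E`.
Then `w_n ≤ E` for all `n`. Here `g (n+1) s` stands for `g_s^{n+1}`. -/
theorem discrete_gronwall_induction (E : ℝ) (hE : 0 ≤ E) (w : ℕ → ℝ)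
    (hw : ∀ n, 0 ≤ w n) (hw0 : w 0 ≤ E) (g : ℕ → ℕ → ℝ)
    (hgpos : ∀ n : ℕ, 0 < g (n + 1) 0)
    (hgmono : ∀ n : ℕ, ∀ s < n, g (n + 1) s ≤ g (n + 1) (s + 1))
    (hrec : ∀ n : ℕ, g (n + 1) n * w (n + 1)
      ≤ (∑ s ∈ Finset.Icc 1 n, (g (n + 1) s - g (n + 1) (s - 1)) * w s)
        + g (n + 1) 0 * E) :
    ∀ n, w n ≤ E := by
  intro n
  induction n using Nat.strong_induction_on with
  | _ n ih =>
    cases n with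
    | zero => exact hw0
    | succ n =>
      have key : ∀ m : ℕ, m ≤ n → 0 < g (n + 1) m ∧
          (∑ s ∈ Finset.Icc 1 m, (g (n + 1) s - g (n + 1) (s - 1)) * w s)
            + g (n + 1) 0 * E ≤ g (n + 1) m * E := by
        intro m
        induction m with
        | zero =>
          intro _
          exact ⟨hgpos n, by simp⟩
        | succ m ihm =>
          intro hm
          obtain ⟨h1, h2⟩ := ihm (by omega)
          have h3 := hgmono n m (by omega)
          refine ⟨lt_of_lt_of_le h1 h3, ?_⟩
          rw [Finset.sum_Icc_succ_top (by omega), Nat.add_sub_cancel]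
          have h4 := mul_le_mul_of_nonneg_left (ih (m + 1) (by omega)) (sub_nonneg.mpr h3)
          linarith
      obtain ⟨h1, h2⟩ := key n le_rfl
      exact le_of_mul_le_mul_left ((hrec n).trans h2) h1
end
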